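/- arXiv:0904.0281 — 2 statements merged into one kernel-verified Lean document; each statement's English description precedes it below -/
import Mathlib

section
/- Let {M_n} be a family of sets satisfying properties 1–5 and ρ ∈ D(ℋ). For every real y > E_M^∞(ρ), lim_{n→∞} min_{ω_n ∈ M_n} tr(ρ^{⊗n} − 2^{yn} ω_n)₊ = 0; and for every real y < E_M^∞(ρ), liminf_{n→∞} min_{ω_n ∈ M_n} tr(ρ^{⊗n} − 2^{yn} ω_n)₊ > 0. -/
open scoped BigOperators
open Filter ComplexOrder

noncomputable section

namespace GQSL

variable {I : Type*} [Fintype I] [DecidableEq I]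

/-- A quantum state: a positive semidefinite matrix of unit trace. -/
def IsState (ρ : Matrix I I ℂ) : Prop := ρ.PosSemidef ∧ ρ.trace = 1

/-- The `n`-fold tensor power of an operator, realized on `Fin n → I` indices. -/
def tpow (ρ : Matrix I I ℂ) (n : ℕ) : Matrix (Fin n → I) (Fin n → I) ℂ :=
  fun x y => ∏ i, ρ (x i) (y i)

/-- Functional calculus for Hermitian matrices (junk value `0` otherwise). -/
def fcal (f : ℝ → ℝ) (A : Matrix I I ℂ) : Matrix I I ℂ :=
  if hA : A.IsHermitian then
    (hA.eigenvectorUnitary : Matrix I I ℂ) *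
      Matrix.diagonal (fun i => (f (hA.eigenvalues i) : ℂ)) *
      star (hA.eigenvectorUnitary : Matrix I I ℂ)
  else 0

/-- Base-2 matrix logarithm, computed on the support. -/
def mlog (A : Matrix I I ℂ) : Matrix I I ℂ :=
  fcal (fun x => if 0 < x then Real.logb 2 x else 0) A

/-- Real matrix power, computed on the support (generalized inverse powers). -/
def mpow (A : Matrix I I ℂ) (t : ℝ) : Matrix I I ℂ :=
  fcal (fun x => if 0 < x then x ^ t else 0) A

/-- Matrix square root of a positive semidefinite matrix. -/
def msqrt (A : Matrix I I ℂ) : Matrix I I ℂ := fcal Real.sqrt A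

/-- Trace norm `‖A‖₁ = tr √(AᴴA)`. -/
def trNorm (A : Matrix I I ℂ) : ℝ := ((msqrt (A.conjTranspose * A)).trace).re

/-- Trace of the positive part of a Hermitian matrix: the sum of its positive eigenvalues. -/
def trPos (A : Matrix I I ℂ) : ℝ := ((fcal (fun x => max x 0) A).trace).re

/-- Fidelity `F(A,B) = tr √(√A B √A)`. -/
def fid (A B : Matrix I I ℂ) : ℝ := ((msqrt (msqrt A * B * msqrt A)).trace).re

/-- Von Neumann entropy (base 2). -/
def vnEnt (A : Matrix I I ℂ) : ℝ := -((A * mlog A).trace).re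

/-- `supp ρ ⊆ supp σ`, expressed via kernels. -/
def SuppLe (ρ σ : Matrix I I ℂ) : Prop := ∀ v, σ.mulVec v = 0 → ρ.mulVec v = 0

/-- Quantum relative entropy `S(ρ‖σ) = tr(ρ(log₂ρ − log₂σ))` (finite-value formula,
meaningful when `SuppLe ρ σ` holds). -/
def relEnt (ρ σ : Matrix I I ℂ) : ℝ := ((ρ * (mlog ρ - mlog σ)).trace).re

/-- `E_M(ρ) = inf {S(ρ‖σ) : σ ∈ M}`; states `σ` violating the support condition
have `S(ρ‖σ) = +∞` and hence do not contribute to the infimum. -/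
def EMset (M : Set (Matrix I I ℂ)) (ρ : Matrix I I ℂ) : ℝ :=
  sInf {x | ∃ σ ∈ M, SuppLe ρ σ ∧ x = relEnt ρ σ}

/-- Max-relative entropy `S_max(ρ‖σ) = inf {s : ρ ≤ 2^s σ}`. -/
def Smax (ρ σ : Matrix I I ℂ) : ℝ := sInf {s : ℝ | (((2:ℝ) ^ s) • σ - ρ).PosSemidef}

/-- Log robustness with respect to a set `M`. -/
def LR (M : Set (Matrix I I ℂ)) (ρ : Matrix I I ℂ) : ℝ :=
  sInf {x | ∃ σ ∈ M, x = Smax ρ σ}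

/-- Smoothed log robustness. -/
def LReps (M : Set (Matrix I I ℂ)) (ε : ℝ) (ρ : Matrix I I ℂ) : ℝ :=
  sInf {x | ∃ ρ', IsState ρ' ∧ trNorm (ρ' - ρ) ≤ ε ∧ x = LR M ρ'}

/-- Partial trace over the `k`-th tensor factor. -/
def ptraceAt {n : ℕ} (k : Fin (n + 1)) (ρ : Matrix (Fin (n + 1) → I) (Fin (n + 1) → I) ℂ) :
    Matrix (Fin n → I) (Fin n → I) ℂ :=
  fun x y => ∑ a : I, ρ (k.insertNth a x) (k.insertNth a y)

/-- Tensor product of operators on `n` and `m` copies. -/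
def tprod {n m : ℕ} (ρ : Matrix (Fin n → I) (Fin n → I) ℂ)
    (ν : Matrix (Fin m → I) (Fin m → I) ℂ) :
    Matrix (Fin (n + m) → I) (Fin (n + m) → I) ℂ :=
  fun x y => ρ (fun i => x (Fin.castAdd m i)) (fun i => y (Fin.castAdd m i)) *
    ν (fun j => x (Fin.natAdd n j)) (fun j => y (Fin.natAdd n j))

/-- Conjugation `P_π ρ P_π†` by the permutation unitary. -/
def permute {n : ℕ} (π : Equiv.Perm (Fin n)) (ρ : Matrix (Fin n → I) (Fin n → I) ℂ) :
    Matrix (Fin n → I) (Fin n → I) ℂ :=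
  fun x y => ρ (x ∘ π) (y ∘ π)

/-- A family of sets of states satisfying properties 1–5, with `σ` the fixed
full-rank state of property 2. -/
structure GoodFamily {d : ℕ} (σ : Matrix (Fin d) (Fin d) ℂ)
    (M : ∀ n : ℕ, Set (Matrix (Fin n → Fin d) (Fin n → Fin d) ℂ)) : Prop where
  states : ∀ n, ∀ ρ ∈ M n, IsState ρ
  convex : ∀ n, Convex ℝ (M n)
  closed : ∀ n, IsClosed (M n)
  sigma_state : IsState σ
  sigma_posdef : σ.PosDef
  sigma_mem : ∀ n, tpow σ n ∈ M n
  ptrace_mem : ∀ n (k : Fin (n + 1)), ∀ ρ ∈ M (n + 1), ptraceAt k ρ ∈ M n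
  tprod_mem : ∀ n m, ∀ ρ ∈ M n, ∀ ν ∈ M m, tprod ρ ν ∈ M (n + m)
  perm_mem : ∀ n (π : Equiv.Perm (Fin n)), ∀ ρ ∈ M n, permute π ρ ∈ M n

/-- The rank-one operator `|f⟩⟨f|`. -/
def vecOp {J : Type*} (f : J → ℂ) : Matrix J J ℂ := fun x y => f x * star (f y)

/-- Squared ℓ²-norm of a vector. -/
def vecNormSq {J : Type*} [Fintype J] (f : J → ℂ) : ℝ := ∑ x, Complex.normSq (f x)

/-- ℓ²-norm of a vector. -/
def l2norm {J : Type*} [Fintype J] (f : J → ℂ) : ℝ := Real.sqrt (vecNormSq f)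

/-- Membership in the symmetric subspace. -/
def IsSymVec {J : Type*} {N : ℕ} (f : (Fin N → J) → ℂ) : Prop :=
  ∀ (π : Equiv.Perm (Fin N)) (x : Fin N → J), f (x ∘ π) = f x

/-- Unnormalized symmetrization `Σ_π P_π ψ`. -/
def symmetrize {J : Type*} {N : ℕ} (ψ : (Fin N → J) → ℂ) : (Fin N → J) → ℂ :=
  fun x => ∑ π : Equiv.Perm (Fin N), ψ (x ∘ π)

/-- Normalized symmetrization `Sym(ψ)`. -/
def SymOf {J : Type*} [Fintype J] {N : ℕ} (ψ : (Fin N → J) → ℂ) : (Fin N → J) → ℂ :=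
  ((l2norm (symmetrize ψ) : ℂ))⁻¹ • symmetrize ψ

/-- Partial trace over the first `m` of `m + k` tensor factors. -/
def ptraceFirst {J : Type*} [Fintype J] [DecidableEq J] {m k : ℕ}
    (ρ : Matrix (Fin (m + k) → J) (Fin (m + k) → J) ℂ) :
    Matrix (Fin k → J) (Fin k → J) ℂ :=
  fun x y => ∑ a : Fin m → J, ρ (Fin.append a x) (Fin.append a y)

/-- Partial trace over the environment components of `N` system–environment pairs. -/
def ptraceE {A E : Type*} [Fintype A] [Fintype E] {N : ℕ}
    (ρ : Matrix (Fin N → A × E) (Fin N → A × E) ℂ) :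
    Matrix (Fin N → A) (Fin N → A) ℂ :=
  fun x y => ∑ e : Fin N → E, ρ (fun i => (x i, e i)) (fun i => (y i, e i))

/-- The set of `(N choose r)`-i.i.d. vectors along `θ`: vectors which are `θ` on
`N − r` of the positions (the permutations of `θ^{⊗(N−r)} ⊗ ψ_r`). -/
def powVecSet {J : Type*} (θ : J → ℂ) (N r : ℕ) : Set ((Fin N → J) → ℂ) :=
  {f | ∃ S : Finset (Fin N), S.card = N - r ∧
    ∃ ψ : ({i : Fin N // i ∉ S} → J) → ℂ,
      f = fun x => (∏ i ∈ S, θ (x i)) * ψ (fun j => x j.1)}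

/-- Almost power states along `θ`: `|θ⟩^{[⊗,N,r]} = Sym(ℋ^{⊗N}) ∩ span V(ℋ^{⊗N}, θ^{⊗N−r})`. -/
def almostPower {J : Type*} (θ : J → ℂ) (N r : ℕ) : Set ((Fin N → J) → ℂ) :=
  {f | IsSymVec f ∧ f ∈ Submodule.span ℂ (powVecSet θ N r)}

/-- `η ⊗ θ^{⊗(N−k)}`: the vector `η` on the first `k` slots and `θ` on the rest. -/
def etaTensor {J : Type*} {N k : ℕ} (h : k ≤ N) (η : (Fin k → J) → ℂ) (θ : J → ℂ) :
    (Fin N → J) → ℂ :=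
  fun x => η (fun i => x (Fin.castLE h i)) * ∏ i : Fin N, if (i : ℕ) < k then 1 else θ (x i)

/-- `η` lies in the `k`-fold tensor power of the orthogonal complement of `θ`:
the contraction of `η` with `⟨θ|` at any slot vanishes. -/
def InPerpPow {J : Type*} [Fintype J] [DecidableEq J] {k : ℕ} (θ : J → ℂ)
    (η : (Fin k → J) → ℂ) : Prop :=
  ∀ (j : Fin k) (z : Fin k → J), ∑ a : J, star (θ a) * η (Function.update z j a) = 0

/-- Binary Shannon entropy. -/
def binEnt (x : ℝ) : ℝ := -(x * Real.logb 2 x) - (1 - x) * Real.logb 2 (1 - x)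

/-- Product operator `σ₁ ⊗ ⋯ ⊗ σ_k` of a `k`-partite system. -/
def prodOp {k : ℕ} {ι : Fin k → Type*} [∀ i, Fintype (ι i)]
    (σs : ∀ i, Matrix (ι i) (ι i) ℂ) : Matrix (∀ i, ι i) (∀ i, ι i) ℂ :=
  fun x y => ∏ i, σs i (x i) (y i)

/-- Separability of a `k`-partite state: a finite convex combination of product states. -/
def IsSeparable {k : ℕ} {ι : Fin k → Type*} [∀ i, Fintype (ι i)]
    (ρ : Matrix (∀ i, ι i) (∀ i, ι i) ℂ) : Prop :=
  ∃ (m : ℕ) (p : Fin m → ℝ) (σs : Fin m → ∀ i, Matrix (ι i) (ι i) ℂ),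
    (∀ j, 0 ≤ p j) ∧ (∑ j, p j = 1) ∧ (∀ j i, IsState (σs j i)) ∧
    ρ = ∑ j, p j • prodOp (σs j)

/-- Relative entropy of entanglement `E_R(ρ) = inf {S(ρ‖ω) : ω separable}`. -/
def ERel {k : ℕ} {ι : Fin k → Type*} [∀ i, Fintype (ι i)] [∀ i, DecidableEq (ι i)]
    (ρ : Matrix (∀ i, ι i) (∀ i, ι i) ℂ) : ℝ :=
  sInf {x | ∃ ω, IsSeparable ω ∧ SuppLe ρ ω ∧ x = relEnt ρ ω}

/-- `ρ^{⊗n}` of a `k`-partite state, viewed as a `k`-partite state where the `i`-th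
party holds the `n` copies of its system. -/
def tpowMulti {k : ℕ} {d : Fin k → ℕ} (ρ : Matrix (∀ i, Fin (d i)) (∀ i, Fin (d i)) ℂ)
    (n : ℕ) : Matrix (∀ i, Fin n → Fin (d i)) (∀ i, Fin n → Fin (d i)) ℂ :=
  fun x y => ∏ t : Fin n, ρ (fun i => x i t) (fun i => y i t)

/-- `ρ^{⊗n}` of a bipartite state in the grouped bipartition `A^{⊗n} : B^{⊗n}`. -/
def tpowBi {A B : Type*} [Fintype A] [Fintype B]
    (ρ : Matrix (A × B) (A × B) ℂ) (n : ℕ) :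
    Matrix ((Fin n → A) × (Fin n → B)) ((Fin n → A) × (Fin n → B)) ℂ :=
  fun x y => ∏ i, ρ (x.1 i, x.2 i) (y.1 i, y.2 i)

/-- `k`-extendibility of a bipartite state. -/
def IsKExtendible {A B : Type*} [Fintype A] [Fintype B] (k : ℕ)
    (σ : Matrix (A × B) (A × B) ℂ) : Prop :=
  ∃ σ' : Matrix (A × (Fin k → B)) (A × (Fin k → B)) ℂ,
    IsState σ' ∧
    (∀ (π : Equiv.Perm (Fin k)) (p q : A × (Fin k → B)),
      σ' (p.1, p.2 ∘ π) (q.1, q.2 ∘ π) = σ' p q) ∧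
    (∀ p q : A × B, σ p q =
      ∑ f : {i : Fin k // (i : ℕ) ≠ 0} → B,
        σ' (p.1, fun i => if h : (i : ℕ) = 0 then p.2 else f ⟨i, h⟩)
           (q.1, fun i => if h : (i : ℕ) = 0 then q.2 else f ⟨i, h⟩))

section StrongConverse

open Matrix

/-- The operator `∑ᵢ gᵢ |uᵢ⟩⟨uᵢ|` for the columns `uᵢ` of `U`. -/
def udiag (U : Matrix I I ℂ) (g : I → ℝ) : Matrix I I ℂ :=
  U * diagonal (fun i => (g i : ℂ)) * Uᴴ

/-- The diagonal matrix elements `⟨vⱼ, A vⱼ⟩` in the columns `vⱼ` of `V`. -/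
def wt (A V : Matrix I I ℂ) (j : I) : ℝ := ((Vᴴ * A * V) j j).re

lemma udiag_posSemidef (U : Matrix I I ℂ) {g : I → ℝ} (hg : ∀ i, 0 ≤ g i) :
    (udiag U g).PosSemidef := by
  apply PosSemidef.mul_mul_conjTranspose_same
  apply PosSemidef.diagonal
  intro i
  simpa using hg i

lemma udiag_add (U : Matrix I I ℂ) (f g : I → ℝ) :
    udiag U (fun i => f i + g i) = udiag U f + udiag U g := by
  simp only [udiag, Complex.ofReal_add]
  rw [← diagonal_add, Matrix.mul_add, Matrix.add_mul]

lemma udiag_sub (U : Matrix I I ℂ) (f g : I → ℝ) :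
    udiag U (fun i => f i - g i) = udiag U f - udiag U g := by
  rw [eq_sub_iff_add_eq, ← udiag_add]
  simp

lemma udiag_smul (U : Matrix I I ℂ) (c : ℝ) (g : I → ℝ) :
    udiag U (fun i => c * g i) = c • udiag U g := by
  have : diagonal (fun i => ((c * g i : ℝ) : ℂ)) = c • diagonal (fun i => (g i : ℂ)) := by
    ext i j
    by_cases h : i = j <;> simp [h, diagonal]
  rw [udiag, this, udiag]
  simp

lemma udiag_one {U : Matrix I I ℂ} (hU : Uᴴ * U = 1) : udiag U (fun _ => 1) = 1 := by
  simp [udiag, mul_eq_one_comm.mp hU]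

lemma udiag_mul {U : Matrix I I ℂ} (hU : Uᴴ * U = 1) (f g : I → ℝ) :
    udiag U f * udiag U g = udiag U (fun i => f i * g i) := by
  simp only [udiag, Complex.ofReal_mul]
  rw [← diagonal_mul_diagonal]
  simp only [Matrix.mul_assoc]
  rw [← Matrix.mul_assoc Uᴴ U, hU, Matrix.one_mul]

lemma udiag_sub_posSemidef (U : Matrix I I ℂ) {f g : I → ℝ} (h : ∀ i, f i ≤ g i) :
    (udiag U g - udiag U f).PosSemidef := by
  rw [← udiag_sub]
  exact udiag_posSemidef U fun i => sub_nonneg.mpr (h i)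

lemma udiag_conjTranspose (U : Matrix I I ℂ) (g : I → ℝ) : (udiag U g)ᴴ = udiag U g := by
  simp only [udiag, conjTranspose_mul, conjTranspose_conjTranspose, diagonal_conjTranspose,
    Matrix.mul_assoc]
  congr 3
  ext i
  simp

lemma trace_mul_udiag (A V : Matrix I I ℂ) (g : I → ℝ) :
    (A * udiag V g).trace.re = ∑ j, g j * wt A V j := by
  have : (A * udiag V g).trace = ((Vᴴ * A * V) * diagonal (fun i => (g i : ℂ))).trace := by
    rw [udiag, ← Matrix.mul_assoc, trace_mul_comm]
    simp only [Matrix.mul_assoc]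
  rw [this, trace, Complex.re_sum]
  refine Finset.sum_congr rfl fun j _ => ?_
  rw [diag_apply, mul_diagonal, Complex.re_mul_ofReal, wt, mul_comm]

lemma wt_nonneg {A : Matrix I I ℂ} (hA : A.PosSemidef) (V : Matrix I I ℂ) (j : I) :
    0 ≤ wt A V j :=
  (Complex.le_def.mp (hA.conjTranspose_mul_mul_same V).diag_nonneg).1

lemma wt_sum (A : Matrix I I ℂ) {V : Matrix I I ℂ} (hV : Vᴴ * V = 1) :
    ∑ j, wt A V j = A.trace.re := by
  have := trace_mul_udiag A V (fun _ => 1)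
  rw [udiag_one hV, Matrix.mul_one] at this
  simp [this]

lemma conj_udiag {U : Matrix I I ℂ} (hU : Uᴴ * U = 1) (a : I → ℝ) :
    Uᴴ * udiag U a * U = diagonal (fun i => (a i : ℂ)) := by
  simp only [udiag, Matrix.mul_assoc]
  rw [hU, Matrix.mul_one, ← Matrix.mul_assoc, hU, Matrix.one_mul]

lemma wt_udiag_self {U : Matrix I I ℂ} (hU : Uᴴ * U = 1) (a : I → ℝ) (i : I) :
    wt (udiag U a) U i = a i := by
  simp [wt, conj_udiag hU]

lemma trace_udiag {U : Matrix I I ℂ} (hU : Uᴴ * U = 1) (a : I → ℝ) :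
    (udiag U a).trace.re = ∑ i, a i := by
  rw [← wt_sum _ hU]
  simp [wt_udiag_self hU]

lemma exists_udiag {A : Matrix I I ℂ} (hA : A.IsHermitian) :
    ∃ (U : Matrix I I ℂ) (a : I → ℝ), Uᴴ * U = 1 ∧ A = udiag U a ∧
      ∀ f : ℝ → ℝ, fcal f A = udiag U (fun i => f (a i)) := by
  refine ⟨hA.eigenvectorUnitary, hA.eigenvalues, ?_, ?_, fun f => ?_⟩
  · exact (Matrix.mem_unitaryGroup_iff').mp hA.eigenvectorUnitary.2
  · have := hA.spectral_theorem
    rw [Unitary.conjStarAlgAut_apply] at this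
    exact this
  · rw [fcal, dif_pos hA]
    rfl

lemma exists_udiag_of_posSemidef {A : Matrix I I ℂ} (hA : A.PosSemidef) :
    ∃ (U : Matrix I I ℂ) (a : I → ℝ), Uᴴ * U = 1 ∧ (∀ i, 0 ≤ a i) ∧ A = udiag U a ∧
      mlog A = udiag U (fun i => Real.logb 2 (a i)) := by
  obtain ⟨U, a, hU, hA', hf⟩ := exists_udiag hA.isHermitian
  have ha : ∀ i, 0 ≤ a i := fun i => by
    rw [← wt_udiag_self hU a i, ← hA']
    exact wt_nonneg hA U i
  refine ⟨U, a, hU, ha, hA', ?_⟩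
  rw [mlog, hf]
  congr 1
  ext i
  split_ifs with h
  · rfl
  · rw [le_antisymm (not_lt.mp h) (ha i), Real.logb_zero]

lemma trace_mul_nonneg {A B : Matrix I I ℂ} (hA : A.PosSemidef) (hB : B.PosSemidef) :
    0 ≤ (A * B).trace.re := by
  obtain ⟨V, b, _, hb, rfl, _⟩ := exists_udiag_of_posSemidef hB
  rw [trace_mul_udiag]
  exact Finset.sum_nonneg fun j _ => mul_nonneg (hb j) (wt_nonneg hA V j)

lemma trace_mul_le_of_le {A B C : Matrix I I ℂ} (h : (B - A).PosSemidef) (hC : C.PosSemidef) :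
    (A * C).trace.re ≤ (B * C).trace.re := by
  have := trace_mul_nonneg h hC
  rw [Matrix.sub_mul, trace_sub, Complex.sub_re] at this
  linarith

lemma trace_le_of_le {A B : Matrix I I ℂ} (h : (B - A).PosSemidef) :
    A.trace.re ≤ B.trace.re := by
  simpa using trace_mul_le_of_le h PosSemidef.one

lemma posSemidef_real_smul {A : Matrix I I ℂ} (hA : A.PosSemidef) {c : ℝ} (hc : 0 ≤ c) :
    (c • A).PosSemidef := hA.smul hc

lemma wt_mono {A B : Matrix I I ℂ} (h : (B - A).PosSemidef) (V : Matrix I I ℂ) (j : I) :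
    wt A V j ≤ wt B V j := by
  have := wt_nonneg h V j
  simp only [wt, Matrix.mul_sub, Matrix.sub_mul, Matrix.sub_apply, Complex.sub_re] at this ⊢
  linarith

lemma trPos_le {H X : Matrix I I ℂ} (hH : H.IsHermitian) (hX : X.PosSemidef)
    (h : (X - H).PosSemidef) : trPos H ≤ X.trace.re := by
  obtain ⟨U, a, hU, hA, hf⟩ := exists_udiag hH
  rw [trPos, hf, trace_udiag hU, ← wt_sum X hU]
  refine Finset.sum_le_sum fun i _ => max_le ?_ (wt_nonneg hX U i)
  rw [← wt_udiag_self hU a i, ← hA]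
  exact wt_mono h U i

lemma exists_posPart {H : Matrix I I ℂ} (hH : H.IsHermitian) :
    ∃ X : Matrix I I ℂ, X.PosSemidef ∧ (X - H).PosSemidef ∧ X.trace.re = trPos H := by
  obtain ⟨U, a, hU, hA, hf⟩ := exists_udiag hH
  refine ⟨udiag U (fun i => max (a i) 0), udiag_posSemidef U fun i => le_max_right _ _, ?_, ?_⟩
  · rw [hA]
    exact udiag_sub_posSemidef U fun i => le_max_left _ _
  · rw [trPos, hf]

lemma trPos_nonneg {H : Matrix I I ℂ} (hH : H.IsHermitian) : 0 ≤ trPos H := by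
  obtain ⟨X, hX, _, h⟩ := exists_posPart hH
  rw [← h]
  exact (Complex.le_def.mp hX.trace_nonneg).1

/-- Operator form of `|x + y|² ≤ (1 + t)|x|² + (1 + 1/t)|y|²`. -/
lemma conj_add_le {K : Matrix I I ℂ} (hK : K.PosSemidef) (X Y : Matrix I I ℂ) {t : ℝ}
    (ht : 0 < t) :
    ((1 + t) • (X * K * Xᴴ) + (1 + t⁻¹) • (Y * K * Yᴴ) - (X + Y) * K * (X + Y)ᴴ).PosSemidef := by
  have h := posSemidef_real_smul (hK.mul_mul_conjTranspose_same (t • X - Y))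
    (inv_nonneg.mpr ht.le)
  convert h using 1
  simp only [conjTranspose_add, conjTranspose_sub, conjTranspose_smul, Matrix.mul_add,
    Matrix.add_mul, Matrix.mul_sub, Matrix.sub_mul, smul_sub, Matrix.smul_mul, Matrix.mul_smul,
    smul_smul, add_smul, one_smul, star_trivial]
  rw [show t⁻¹ * (t * t) = t by field_simp, inv_mul_cancel₀ ht.ne', one_smul, one_smul]
  abel

lemma wt_eq_zero_of_suppLe {A V : Matrix I I ℂ} {b : I → ℝ} (hV : Vᴴ * V = 1)
    (h : SuppLe A (udiag V b)) {j : I} (hj : b j = 0) : wt A V j = 0 := by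
  have hk : (udiag V b).mulVec (V.mulVec (Pi.single j 1)) = 0 := by
    rw [mulVec_mulVec, udiag, Matrix.mul_assoc, hV, Matrix.mul_one, ← mulVec_mulVec]
    have : (diagonal fun i => (b i : ℂ)).mulVec (Pi.single j 1) = 0 := by
      ext i
      by_cases hij : i = j <;> simp [mulVec_diagonal, hij, hj]
    rw [this, mulVec_zero]
  have h' := h _ hk
  have : (Vᴴ * A * V) j j = ((Vᴴ * A * V).mulVec (Pi.single j 1)) j := by simp
  rw [wt, this, ← mulVec_mulVec, ← mulVec_mulVec, h', mulVec_zero]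
  simp

lemma relEnt_udiag {A B U V : Matrix I I ℂ} {a b : I → ℝ} (hU : Uᴴ * U = 1)
    (hA : A = udiag U a) (hmA : mlog A = udiag U (fun i => Real.logb 2 (a i)))
    (hmB : mlog B = udiag V (fun i => Real.logb 2 (b i))) :
    relEnt A B = ∑ i, Real.logb 2 (a i) * a i - ∑ j, Real.logb 2 (b j) * wt A V j := by
  rw [relEnt, Matrix.mul_sub, trace_sub, Complex.sub_re, hmA, hmB, trace_mul_udiag,
    trace_mul_udiag]
  congr 1
  refine Finset.sum_congr rfl fun i _ => ?_
  rw [hA, wt_udiag_self hU]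

/-- One-shot achievability: cutting off the eigenvalues of `A` above `l` and those of `B`
below `m`. -/
lemma trPos_sub_le_cutoff {U V : Matrix I I ℂ} {a b : I → ℝ} (hU : Uᴴ * U = 1)
    (hV : Vᴴ * V = 1) (ha : ∀ i, 0 ≤ a i) (hb : ∀ i, 0 ≤ b i) {l m K : ℝ} (hl : 0 ≤ l)
    (hK : 0 ≤ K) (h : 2 * l ≤ K * m) :
    trPos (udiag U a - K • udiag V b) ≤
      2 * ∑ j, (if b j < m then 1 else 0) * wt (udiag U a) V j +
        ∑ i, if l < a i then a i else 0 := by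
  set A := udiag U a with hAdef
  set A₁ := udiag U (fun i => if l < a i then 0 else a i) with hA₁
  set A₂ := udiag U (fun i => if l < a i then a i else 0) with hA₂
  set Q := udiag V (fun j => if b j < m then 0 else 1) with hQ
  set R := udiag V (fun j => if b j < m then 1 else 0) with hR
  have hA : A = A₁ + A₂ := by
    rw [hA₁, hA₂, ← udiag_add, hAdef]
    congr 1
    ext i
    split_ifs <;> simp
  have hQR : Q + R = 1 := by
    rw [hQ, hR, ← udiag_add, ← udiag_one hV]
    congr 1
    ext i
    split_ifs <;> simp
  have hA₁p : A₁.PosSemidef := udiag_posSemidef U fun i => by split_ifs <;> simp [ha i]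
  have hA₂p : A₂.PosSemidef := udiag_posSemidef U fun i => by split_ifs <;> simp [ha i]
  have hRR : R * R = R := by
    rw [hR, udiag_mul hV]
    congr 1
    ext i
    split_ifs <;> simp
  have hQQ : Q * Q = Q := by
    rw [hQ, udiag_mul hV]
    congr 1
    ext i
    split_ifs <;> simp
  have hRh : Rᴴ = R := udiag_conjTranspose _ _
  have hQh : Qᴴ = Q := udiag_conjTranspose _ _
  have hsplit := conj_add_le hA₁p Q R one_pos
  rw [hQR, conjTranspose_one, Matrix.mul_one, Matrix.one_mul, hQh, hRh] at hsplit
  norm_num at hsplit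
  have hA₁l : (l • (1 : Matrix I I ℂ) - A₁).PosSemidef := by
    rw [← udiag_one hU, ← udiag_smul]
    refine udiag_sub_posSemidef U fun i => ?_
    split_ifs with hi
    · simpa using hl
    · simpa using hi
  have hQA := hA₁l.mul_mul_conjTranspose_same Q
  rw [hQh, Matrix.mul_sub, Matrix.sub_mul, Matrix.mul_smul, Matrix.mul_one, Matrix.smul_mul,
    hQQ] at hQA
  have hQB : (K • udiag V b - (2 * l) • Q).PosSemidef := by
    rw [hQ, ← udiag_smul, ← udiag_smul]
    refine udiag_sub_posSemidef V fun j => ?_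
    split_ifs with hj
    · simpa using mul_nonneg hK (hb j)
    · have := mul_le_mul_of_nonneg_left (not_lt.mp hj) hK
      linarith
  have hX : (A₂ + (2 : ℝ) • (R * A₁ * R)).PosSemidef := by
    refine hA₂p.add (posSemidef_real_smul ?_ two_pos.le)
    simpa [hRh] using hA₁p.mul_mul_conjTranspose_same R
  have hle : (A₂ + (2 : ℝ) • (R * A₁ * R) - (A - K • udiag V b)).PosSemidef := by
    convert (hsplit.add (posSemidef_real_smul hQA two_pos.le)).add hQB using 1
    rw [hA, smul_sub, smul_smul]
    abel
  have hHerm : (A - K • udiag V b).IsHermitian :=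
    (udiag_posSemidef U ha).isHermitian.sub
      (posSemidef_real_smul (udiag_posSemidef V hb) hK).isHermitian
  refine (trPos_le hHerm hX hle).trans ?_
  have hRp : R.PosSemidef := udiag_posSemidef V fun i => by split_ifs <;> simp
  have htr : (R * A₁ * R).trace.re ≤ (A * R).trace.re := by
    rw [trace_mul_comm, ← Matrix.mul_assoc, hRR, trace_mul_comm]
    apply trace_mul_le_of_le _ hRp
    rw [hA, add_sub_cancel_left]
    exact hA₂p
  have hAR : (A * R).trace.re = ∑ j, (if b j < m then 1 else 0) * wt A V j :=
    trace_mul_udiag A V _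
  rw [trace_add, trace_smul, Complex.add_re, Complex.smul_re, hA₂, trace_udiag hU, smul_eq_mul]
  linarith

lemma cutoff_above_le {a l s : ℝ} (ha : 0 ≤ a) (hl : 0 < l) (hs : 0 < s) :
    (if l < a then a else 0) ≤ l ^ (-s) * a ^ (1 + s) := by
  split_ifs with h
  · have h0 : 0 < a := hl.trans h
    rw [Real.rpow_add h0, Real.rpow_one, Real.rpow_neg hl.le]
    have h1 : 1 ≤ (l ^ s)⁻¹ * a ^ s := by
      rw [← div_eq_inv_mul, one_le_div (by positivity)]
      exact Real.rpow_le_rpow hl.le h.le hs.le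
    nlinarith
  · positivity

lemma cutoff_below_le {b m s w : ℝ} (hb : 0 ≤ b) (hm : 0 < m) (hs : 0 < s) (hw : 0 ≤ w)
    (h0 : b = 0 → w = 0) :
    (if b < m then 1 else 0) * w ≤ m ^ s * (w * b ^ (-s)) := by
  rcases hb.eq_or_lt with hb0 | hb0
  · simp [h0 hb0.symm]
  split_ifs with h
  · have h1 : 1 ≤ m ^ s * b ^ (-s) := by
      rw [Real.rpow_neg hb, ← div_eq_mul_inv, one_le_div (by positivity)]
      exact Real.rpow_le_rpow hb h.le hs.le
    nlinarith
  · rw [zero_mul]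
    positivity

/-- Diagonalizations of `A` and `B` together with the values of the two moments
`tr A^{1+s}` and `tr A B^{-t}`. -/
def HasMoments (A B : Matrix I I ℂ) (s t φ ψ : ℝ) : Prop :=
  ∃ (U V : Matrix I I ℂ) (a b : I → ℝ), Uᴴ * U = 1 ∧ Vᴴ * V = 1 ∧ (∀ i, 0 ≤ a i) ∧
    (∀ i, 0 ≤ b i) ∧ A = udiag U a ∧ B = udiag V b ∧ (∀ j, b j = 0 → wt A V j = 0) ∧
    ∑ i, a i ^ (1 + s) = φ ∧ ∑ j, wt A V j * b j ^ (-t) = ψ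

lemma HasMoments.trPos_le {A B : Matrix I I ℂ} {s t φ ψ : ℝ} (h : HasMoments A B s t φ ψ)
    (hs : 0 < s) (ht : 0 < t) {l m K : ℝ} (hl : 0 < l) (hm : 0 < m) (hK : 0 ≤ K)
    (hKm : 2 * l ≤ K * m) :
    trPos (A - K • B) ≤ 2 * (m ^ t * ψ) + l ^ (-s) * φ := by
  obtain ⟨U, V, a, b, hU, hV, ha, hb, rfl, rfl, h0, rfl, rfl⟩ := h
  refine (trPos_sub_le_cutoff hU hV ha hb hl.le hK hKm).trans ?_
  rw [Finset.mul_sum Finset.univ _ (m ^ t), Finset.mul_sum Finset.univ _ (l ^ (-s))]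
  have h1 := Finset.sum_le_sum fun j (_ : j ∈ Finset.univ) =>
    cutoff_below_le (hb j) hm ht (wt_nonneg (udiag_posSemidef U ha) V j) (h0 j)
  have h2 := Finset.sum_le_sum fun i (_ : i ∈ Finset.univ) => cutoff_above_le (ha i) hl hs
  linarith

section Tensor

variable {n m : ℕ}

lemma tprod_mul (A C : Matrix (Fin n → I) (Fin n → I) ℂ) (B D : Matrix (Fin m → I) (Fin m → I) ℂ) :
    tprod A B * tprod C D = tprod (A * C) (B * D) := by
  ext x y
  simp only [tprod, Matrix.mul_apply]
  rw [← (Fin.appendEquiv n m).sum_comp, Fintype.sum_prod_type, Finset.sum_mul_sum]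
  refine Finset.sum_congr rfl fun u _ => Finset.sum_congr rfl fun v _ => ?_
  simp [Fin.appendEquiv]
  ring

lemma tprod_conjTranspose (A : Matrix (Fin n → I) (Fin n → I) ℂ)
    (B : Matrix (Fin m → I) (Fin m → I) ℂ) : (tprod A B)ᴴ = tprod Aᴴ Bᴴ := by
  ext x y
  simp [tprod, conjTranspose_apply]

lemma tprod_diagonal (f : (Fin n → I) → ℂ) (g : (Fin m → I) → ℂ) :
    tprod (diagonal f) (diagonal g) =
      diagonal (fun x => f (fun i => x (Fin.castAdd m i)) * g (fun j => x (Fin.natAdd n j))) := by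
  ext x y
  by_cases h : x = y
  · subst h
    simp [tprod]
  · rw [diagonal_apply_ne _ h, tprod]
    by_cases h1 : (fun i => x (Fin.castAdd m i)) = (fun i => y (Fin.castAdd m i))
    · by_cases h2 : (fun j => x (Fin.natAdd n j)) = (fun j => y (Fin.natAdd n j))
      · exact absurd (funext fun k => Fin.addCases (fun i => congrFun h1 i)
          (fun j => congrFun h2 j) k) h
      · rw [diagonal_apply_ne _ h2, mul_zero]
    · rw [diagonal_apply_ne _ h1, zero_mul]

lemma tprod_one : tprod (1 : Matrix (Fin n → I) (Fin n → I) ℂ)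
    (1 : Matrix (Fin m → I) (Fin m → I) ℂ) = 1 := by
  rw [← diagonal_one, ← diagonal_one, tprod_diagonal]
  simp

lemma tprod_udiag (U : Matrix (Fin n → I) (Fin n → I) ℂ) (V : Matrix (Fin m → I) (Fin m → I) ℂ)
    (f : (Fin n → I) → ℝ) (g : (Fin m → I) → ℝ) :
    tprod (udiag U f) (udiag V g) = udiag (tprod U V)
      (fun x => f (fun i => x (Fin.castAdd m i)) * g (fun j => x (Fin.natAdd n j))) := by
  simp only [udiag, tprod_conjTranspose, Complex.ofReal_mul]
  rw [← tprod_mul, ← tprod_mul, tprod_diagonal]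

lemma wt_im {A : Matrix I I ℂ} (hA : A.IsHermitian) (V : Matrix I I ℂ) (j : I) :
    ((Vᴴ * A * V) j j).im = 0 := by
  have := (isHermitian_conjTranspose_mul_mul V hA).coe_re_apply_self j
  rw [← this]
  simp

lemma wt_tprod {A V : Matrix (Fin n → I) (Fin n → I) ℂ} {B W : Matrix (Fin m → I) (Fin m → I) ℂ}
    (hA : A.IsHermitian) (x : Fin (n + m) → I) :
    wt (tprod A B) (tprod V W) x =
      wt A V (fun i => x (Fin.castAdd m i)) * wt B W (fun j => x (Fin.natAdd n j)) := by
  rw [wt, tprod_conjTranspose, tprod_mul, tprod_mul, tprod, Complex.mul_re, wt_im hA, zero_mul,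
    sub_zero, wt, wt]

lemma sum_append_mul (f : (Fin n → I) → ℝ) (g : (Fin m → I) → ℝ) :
    ∑ x : Fin (n + m) → I, f (fun i => x (Fin.castAdd m i)) * g (fun j => x (Fin.natAdd n j)) =
      (∑ u, f u) * ∑ v, g v := by
  rw [← (Fin.appendEquiv n m).sum_comp, Fintype.sum_prod_type, Finset.sum_mul_sum]
  simp [Fin.appendEquiv]

lemma HasMoments.tprod {A B : Matrix (Fin n → I) (Fin n → I) ℂ}
    {A' B' : Matrix (Fin m → I) (Fin m → I) ℂ} {s t φ ψ φ' ψ' : ℝ}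
    (h : HasMoments A B s t φ ψ) (h' : HasMoments A' B' s t φ' ψ') :
    HasMoments (tprod A A') (tprod B B') s t (φ * φ') (ψ * ψ') := by
  obtain ⟨U, V, a, b, hU, hV, ha, hb, rfl, rfl, h0, rfl, rfl⟩ := h
  obtain ⟨U', V', a', b', hU', hV', ha', hb', rfl, rfl, h0', rfl, rfl⟩ := h'
  have hH := (udiag_posSemidef U ha).isHermitian
  refine ⟨_, _, _, _, ?_, ?_, fun x => mul_nonneg (ha _) (ha' _),
    fun x => mul_nonneg (hb _) (hb' _), tprod_udiag _ _ _ _, tprod_udiag _ _ _ _, ?_, ?_, ?_⟩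
  · rw [tprod_conjTranspose, tprod_mul, hU, hU', tprod_one]
  · rw [tprod_conjTranspose, tprod_mul, hV, hV', tprod_one]
  · intro x hx
    rw [wt_tprod hH]
    rcases mul_eq_zero.mp hx with h | h
    · rw [h0 _ h, zero_mul]
    · rw [h0' _ h, mul_zero]
  · rw [← sum_append_mul]
    exact Finset.sum_congr rfl fun x _ => Real.mul_rpow (ha _) (ha' _)
  · rw [← sum_append_mul]
    refine Finset.sum_congr rfl fun x _ => ?_
    rw [wt_tprod hH, Real.mul_rpow (hb _) (hb' _)]
    ring

lemma tpow_add (ρ : Matrix I I ℂ) (n m : ℕ) : tpow ρ (n + m) = tprod (tpow ρ n) (tpow ρ m) := by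
  ext x y
  simp [tpow, tprod, Fin.prod_univ_add]

end Tensor

lemma tpow_mul (A B : Matrix I I ℂ) (n : ℕ) : tpow A n * tpow B n = tpow (A * B) n := by
  ext x y
  simp only [tpow, Matrix.mul_apply, ← Finset.prod_mul_distrib]
  rw [Finset.prod_univ_sum]
  simp

lemma tpow_conjTranspose (A : Matrix I I ℂ) (n : ℕ) : (tpow A n)ᴴ = tpow Aᴴ n := by
  ext x y
  simp [tpow, conjTranspose_apply]

lemma tpow_diagonal (f : I → ℂ) (n : ℕ) :
    tpow (diagonal f) n = diagonal (fun x => ∏ i, f (x i)) := by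
  ext x y
  by_cases h : x = y
  · subst h
    simp [tpow]
  · rw [diagonal_apply_ne _ h, tpow]
    obtain ⟨i, hi⟩ := Function.ne_iff.mp h
    exact Finset.prod_eq_zero (Finset.mem_univ i) (diagonal_apply_ne _ hi)

lemma tpow_one (n : ℕ) : tpow (1 : Matrix I I ℂ) n = 1 := by
  rw [← diagonal_one, tpow_diagonal]
  simp

lemma tpow_udiag (U : Matrix I I ℂ) (a : I → ℝ) (n : ℕ) :
    tpow (udiag U a) n = udiag (tpow U n) (fun x => ∏ i, a (x i)) := by
  simp only [udiag, tpow_conjTranspose, Complex.ofReal_prod]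
  rw [← tpow_mul, ← tpow_mul, tpow_diagonal]

lemma tpow_unitary {U : Matrix I I ℂ} (hU : Uᴴ * U = 1) (n : ℕ) :
    (tpow U n)ᴴ * tpow U n = 1 := by
  rw [tpow_conjTranspose, tpow_mul, hU, tpow_one]

lemma IsState.tpow {ρ : Matrix I I ℂ} (h : IsState ρ) (n : ℕ) : IsState (tpow ρ n) := by
  constructor
  · obtain ⟨U, a, hU, ha, rfl, _⟩ := exists_udiag_of_posSemidef h.1
    rw [tpow_udiag]
    exact udiag_posSemidef _ fun x => Finset.prod_nonneg fun i _ => ha _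
  · have h2 := h.2
    simp only [trace, diag_apply, GQSL.tpow] at h2 ⊢
    have := (Finset.prod_univ_sum (fun _ : Fin n => (Finset.univ : Finset I))
      (fun _ i => ρ i i)).symm
    simpa [h2] using this

/-- `tpow σ n` is bounded below by the `n`-th power of a lower bound of `σ`. -/
lemma exists_tpow_lower_bound {σ : Matrix I I ℂ} (h : IsState σ) (hd : σ.PosDef) :
    ∃ c : ℝ, 0 < c ∧ c ≤ 1 ∧ ∀ n : ℕ, (tpow σ n - (c ^ n) • 1).PosSemidef := by
  obtain ⟨U, a, hU, ha, rfl, _⟩ := exists_udiag_of_posSemidef h.1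
  have hne : Nonempty I := by
    by_contra hne
    rw [not_nonempty_iff] at hne
    have := h.2
    simp [trace] at this
  have hpos : ∀ i, 0 < a i := fun i => by
    have hpd := hd.conjTranspose_mul_mul_same (B := U)
      (mulVec_injective_of_isUnit (IsUnit.of_mul_eq_one _ (mul_eq_one_comm.mp hU)))
    have := (Complex.lt_def.mp (hpd.diag_pos (i := i))).1
    rw [conj_udiag hU] at this
    simpa using this
  obtain ⟨i₀, hi₀⟩ := Finite.exists_min a
  refine ⟨min (a i₀) 1, lt_min (hpos i₀) one_pos, min_le_right _ _, fun n => ?_⟩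
  rw [tpow_udiag, ← udiag_one (tpow_unitary hU n), ← udiag_smul]
  refine udiag_sub_posSemidef _ fun x => ?_
  have := Finset.prod_le_prod (s := Finset.univ) (f := fun _ : Fin n => min (a i₀) 1)
    (g := fun i => a (x i)) (fun i _ => (lt_min (hpos i₀) one_pos).le)
    (fun i _ => (min_le_left _ _).trans (hi₀ _))
  simpa using this

lemma suppLe_of_lower_bound {A B : Matrix I I ℂ} {c : ℝ} (hc : 0 < c)
    (h : (B - c • 1).PosSemidef) : SuppLe A B := by
  intro v hv
  have h1 := h.dotProduct_mulVec_nonneg v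
  rw [sub_mulVec, hv, smul_mulVec, one_mulVec, zero_sub, dotProduct_neg, dotProduct_smul] at h1
  have h2 : (star v ⬝ᵥ v) = 0 := by
    have h3 : 0 ≤ star v ⬝ᵥ v := dotProduct_star_self_nonneg v
    have h4 := (Complex.le_def.mp h1).1
    have h5 := Complex.le_def.mp h3
    simp only [Complex.neg_re, Complex.smul_re, smul_eq_mul, Complex.zero_re, Complex.zero_im]
      at h4 h5
    refine Complex.ext ?_ h5.2.symm
    simp only [Complex.zero_re]
    nlinarith [h5.1]
  rw [dotProduct_star_self_eq_zero.mp h2, mulVec_zero]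

/-- Chernoff-type bound: a negative mean makes some exponential moment smaller than one. -/
lemma exists_exp_moment_lt_one {p x : I → ℝ} (hp : ∑ i, p i = 1) (h : ∑ i, p i * x i < 0) :
    ∃ s : ℝ, 0 < s ∧ ∑ i, p i * Real.exp (s * x i) < 1 := by
  have hd : HasDerivAt (fun s : ℝ => ∑ i, p i * Real.exp (s * x i)) (∑ i, p i * x i) 0 := by
    apply HasDerivAt.fun_sum
    intro i _
    have h1 : HasDerivAt (fun s : ℝ => s * x i) (x i) 0 := by
      simpa using (hasDerivAt_id (0 : ℝ)).mul_const (x i)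
    simpa using (h1.exp).const_mul (p i)
  have hev := (hasDerivAt_iff_tendsto_slope.mp hd).eventually (Iio_mem_nhds h)
  have hev' : ∀ᶠ s in nhdsWithin (0 : ℝ) (Set.Ioi 0),
      slope (fun s : ℝ => ∑ i, p i * Real.exp (s * x i)) 0 s < 0 :=
    hev.filter_mono (nhdsWithin_mono _ fun s hs => ne_of_gt hs)
  obtain ⟨s, hs1, hs2⟩ := (hev'.and self_mem_nhdsWithin).exists
  refine ⟨s, hs2, ?_⟩
  rw [slope_def_field, sub_zero] at hs1
  have := (div_lt_iff₀ hs2).mp hs1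
  simp only [zero_mul, Real.exp_zero, mul_one, hp] at this
  linarith

/-- The length `r + k * m` of a remainder of length `r` followed by `k` blocks of length `m`. -/
def blockLen (m r : ℕ) : ℕ → ℕ
  | 0 => r
  | k + 1 => blockLen m r k + m

lemma blockLen_eq (m r k : ℕ) : blockLen m r k = r + k * m := by
  induction k with
  | zero => simp [blockLen]
  | succ k ih =>
    rw [blockLen, ih]
    ring

lemma exists_hasMoments {A B : Matrix I I ℂ} (hA : A.PosSemidef) (hB : B.PosSemidef)
    (h : SuppLe A B) (s t : ℝ) : ∃ φ ψ, HasMoments A B s t φ ψ := by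
  obtain ⟨U, a, hU, ha, hA', _⟩ := exists_udiag_of_posSemidef hA
  obtain ⟨V, b, hV, hb, rfl, _⟩ := exists_udiag_of_posSemidef hB
  exact ⟨_, _, U, V, a, b, hU, hV, ha, hb, hA', rfl, fun j => wt_eq_zero_of_suppLe hV h, rfl, rfl⟩

lemma rpow_mul_two_rpow_eq {a s c : ℝ} (ha : 0 < a) :
    a ^ s * 2 ^ (c * s) = Real.exp (s * (Real.log 2 * (Real.logb 2 a + c))) := by
  rw [Real.rpow_def_of_pos ha, Real.rpow_def_of_pos two_pos, ← Real.exp_add]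
  congr 1
  have : Real.log 2 * Real.logb 2 a = Real.log a := by
    rw [Real.logb]
    field_simp
  rw [mul_add, this]
  ring

/-- If `S(A‖B) < z` then suitable moments of `A` and `B` separate at rate `z`. -/
lemma exists_moments_lt_one {A B : Matrix I I ℂ} (hA : IsState A) (hB : B.PosSemidef)
    (h : SuppLe A B) {z : ℝ} (hz : relEnt A B < z) :
    ∃ s t φ ψ cA cB : ℝ, 0 < s ∧ 0 < t ∧ 0 ≤ φ ∧ 0 ≤ ψ ∧ HasMoments A B s t φ ψ ∧ cB - cA < z ∧
      φ * 2 ^ (cA * s) < 1 ∧ ψ * 2 ^ (-cB * t) < 1 := by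
  obtain ⟨U, a, hU, ha, hA', hmA⟩ := exists_udiag_of_posSemidef hA.1
  obtain ⟨V, b, hV, hb, rfl, hmB⟩ := exists_udiag_of_posSemidef hB
  have hrel := relEnt_udiag hU hA' hmA hmB
  set HA := ∑ i, Real.logb 2 (a i) * a i
  set HB := ∑ j, Real.logb 2 (b j) * wt A V j
  set δ := (z - relEnt A (udiag V b)) / 3 with hδ
  have hδ0 : 0 < δ := by
    rw [hδ]
    linarith
  have h0 : ∀ j, b j = 0 → wt A V j = 0 := fun j => wt_eq_zero_of_suppLe hV h
  have hlog : 0 < Real.log 2 := Real.log_pos one_lt_two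
  have hsa : ∑ i, a i = 1 := by
    rw [← trace_udiag hU, ← hA', hA.2, Complex.one_re]
  have hsw : ∑ j, wt A V j = 1 := by
    rw [wt_sum A hV, hA.2, Complex.one_re]
  obtain ⟨s, hs, hs1⟩ := exists_exp_moment_lt_one (p := a)
    (x := fun i => Real.log 2 * (Real.logb 2 (a i) + (-HA - δ))) hsa (by
      have : ∑ i, a i * (Real.log 2 * (Real.logb 2 (a i) + (-HA - δ))) =
          Real.log 2 * (HA + (-HA - δ) * ∑ i, a i) := by
        rw [Finset.mul_sum, ← Finset.sum_add_distrib, Finset.mul_sum]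
        exact Finset.sum_congr rfl fun i _ => by ring
      rw [this, hsa]
      nlinarith)
  obtain ⟨t, ht, ht1⟩ := exists_exp_moment_lt_one (p := wt A V)
    (x := fun j => -(Real.log 2 * (Real.logb 2 (b j) + (-HB + δ)))) hsw (by
      have : ∑ j, wt A V j * -(Real.log 2 * (Real.logb 2 (b j) + (-HB + δ))) =
          -(Real.log 2 * (HB + (-HB + δ) * ∑ j, wt A V j)) := by
        simp only [mul_neg, Finset.sum_neg_distrib]
        congr 1
        rw [Finset.mul_sum, ← Finset.sum_add_distrib, Finset.mul_sum]
        exact Finset.sum_congr rfl fun i _ => by ring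
      rw [this, hsw]
      nlinarith)
  refine ⟨s, t, _, _, -HA - δ, -HB + δ, hs, ht, ?_, ?_,
    ⟨U, V, a, b, hU, hV, ha, hb, hA', rfl, h0, rfl, rfl⟩, by linarith, ?_, ?_⟩
  · exact Finset.sum_nonneg fun i _ => Real.rpow_nonneg (ha i) _
  · exact Finset.sum_nonneg fun j _ => mul_nonneg (wt_nonneg hA.1 V j) (Real.rpow_nonneg (hb j) _)
  · refine lt_of_eq_of_lt ?_ hs1
    rw [Finset.sum_mul]
    refine Finset.sum_congr rfl fun i _ => ?_
    rcases (ha i).eq_or_lt with hi | hi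
    · rw [← hi, Real.zero_rpow (by linarith)]
      simp
    · rw [Real.rpow_add hi, Real.rpow_one, mul_assoc, rpow_mul_two_rpow_eq hi]
  · refine lt_of_eq_of_lt ?_ ht1
    rw [Finset.sum_mul]
    refine Finset.sum_congr rfl fun j _ => ?_
    rcases (hb j).eq_or_lt with hj | hj
    · simp [h0 j hj.symm]
    · rw [mul_assoc, show -(-HB + δ) * t = (-HB + δ) * (-t) by ring, rpow_mul_two_rpow_eq hj]
      congr 2
      ring

section Family

variable {d : ℕ} {σ : Matrix (Fin d) (Fin d) ℂ}
  {M : ∀ n : ℕ, Set (Matrix (Fin n → Fin d) (Fin n → Fin d) ℂ)}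

lemma GoodFamily.exists_block (hM : GoodFamily σ M) {ρ : Matrix (Fin d) (Fin d) ℂ} {m r : ℕ}
    {ω : Matrix (Fin m → Fin d) (Fin m → Fin d) ℂ} (hω : ω ∈ M m) {s t φ ψ φ₀ ψ₀ : ℝ}
    (h : HasMoments (tpow ρ m) ω s t φ ψ) (h₀ : HasMoments (tpow ρ r) (tpow σ r) s t φ₀ ψ₀)
    (k : ℕ) : ∃ W ∈ M (blockLen m r k),
      HasMoments (tpow ρ (blockLen m r k)) W s t (φ₀ * φ ^ k) (ψ₀ * ψ ^ k) := by
  induction k with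
  | zero => 
    refine ⟨tpow σ r, hM.sigma_mem r, ?_⟩
    rw [pow_zero, pow_zero, mul_one, mul_one]
    exact h₀
  | succ k ih =>
    obtain ⟨W, hW, hmom⟩ := ih
    refine ⟨tprod W ω, hM.tprod_mem _ _ W hW ω hω, ?_⟩
    have := hmom.tprod h
    rw [mul_assoc, mul_assoc, ← pow_succ, ← pow_succ, ← tpow_add] at this
    exact this

/-- The optimal value of `tr (ρ^{⊗n} - 2^{yn} ω)₊` over `ω ∈ M n`. -/
def minTrPos (M : ∀ n : ℕ, Set (Matrix (Fin n → Fin d) (Fin n → Fin d) ℂ))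
    (ρ : Matrix (Fin d) (Fin d) ℂ) (y : ℝ) (n : ℕ) : ℝ :=
  sInf {x : ℝ | ∃ ω ∈ M n, x = trPos (tpow ρ n - ((2:ℝ) ^ (y * (n:ℝ))) • ω)}

variable {ρ : Matrix (Fin d) (Fin d) ℂ}

lemma GoodFamily.isHermitian_sub (hM : GoodFamily σ M) (hρ : IsState ρ) {n : ℕ}
    {ω : Matrix (Fin n → Fin d) (Fin n → Fin d) ℂ} (hω : ω ∈ M n) (c : ℝ) :
    (tpow ρ n - c • ω).IsHermitian := by
  refine (hρ.tpow n).1.isHermitian.sub ?_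
  have := (hM.states n ω hω).1.isHermitian
  rw [IsHermitian, conjTranspose_smul, this, star_trivial]

lemma GoodFamily.minTrPos_le (hM : GoodFamily σ M) (hρ : IsState ρ) (y : ℝ) {n : ℕ}
    {ω : Matrix (Fin n → Fin d) (Fin n → Fin d) ℂ} (hω : ω ∈ M n) :
    minTrPos M ρ y n ≤ trPos (tpow ρ n - ((2:ℝ) ^ (y * (n:ℝ))) • ω) := by
  refine csInf_le ⟨0, ?_⟩ ⟨ω, hω, rfl⟩
  rintro x ⟨τ, hτ, rfl⟩
  exact trPos_nonneg (hM.isHermitian_sub hρ hτ _)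

lemma GoodFamily.minTrPos_nonneg (hM : GoodFamily σ M) (hρ : IsState ρ) (y : ℝ) (n : ℕ) :
    0 ≤ minTrPos M ρ y n := by
  refine Real.sInf_nonneg ?_
  rintro x ⟨τ, hτ, rfl⟩
  exact trPos_nonneg (hM.isHermitian_sub hρ hτ _)

lemma GoodFamily.suppLe_sigma (hM : GoodFamily σ M) (n : ℕ)
    (A : Matrix (Fin n → Fin d) (Fin n → Fin d) ℂ) : SuppLe A (tpow σ n) := by
  obtain ⟨c, hc, _, h⟩ := exists_tpow_lower_bound hM.sigma_state hM.sigma_posdef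
  exact suppLe_of_lower_bound (pow_pos hc n) (h n)

lemma GoodFamily.tendsto_minTrPos_blockLen (hM : GoodFamily σ M) (hρ : IsState ρ) {y : ℝ}
    {m : ℕ} {ω : Matrix (Fin m → Fin d) (Fin m → Fin d) ℂ} (hω : ω ∈ M m)
    (hsupp : SuppLe (tpow ρ m) ω) (hlt : relEnt (tpow ρ m) ω < y * m) (r : ℕ) :
    Tendsto (fun k => minTrPos M ρ y (blockLen m r k)) atTop (nhds 0) := by
  obtain ⟨s, t, φ, ψ, cA, cB, hs, ht, hφ, hψ, hmom, hc, hφ1, hψ1⟩ :=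
    exists_moments_lt_one (hρ.tpow m) (hM.states m ω hω).1 hsupp hlt
  obtain ⟨φ₀, ψ₀, hmom₀⟩ := exists_hasMoments (hρ.tpow r).1 (hM.sigma_state.tpow r).1
    (hM.suppLe_sigma r _) s t
  have hlim : Tendsto (fun k : ℕ => 2 * (ψ₀ * (ψ * 2 ^ (-cB * t)) ^ k) +
      φ₀ * (φ * 2 ^ (cA * s)) ^ k) atTop (nhds 0) := by
    have h1 := tendsto_pow_atTop_nhds_zero_of_lt_one (r := ψ * 2 ^ (-cB * t)) (by positivity) hψ1
    have h2 := tendsto_pow_atTop_nhds_zero_of_lt_one (r := φ * 2 ^ (cA * s)) (by positivity) hφ1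
    simpa using ((h1.const_mul ψ₀).const_mul 2).add (h2.const_mul φ₀)
  refine tendsto_of_tendsto_of_tendsto_of_le_of_le' tendsto_const_nhds hlim
    (Eventually.of_forall fun k => hM.minTrPos_nonneg hρ y _) ?_
  have hev : ∀ᶠ k : ℕ in atTop, 1 - y * r ≤ k * (y * m - (cB - cA)) :=
    (tendsto_natCast_atTop_atTop.atTop_mul_const (sub_pos.mpr hc)).eventually_ge_atTop _
  filter_upwards [hev] with k hk
  obtain ⟨W, hW, hWm⟩ := hM.exists_block hω hmom hmom₀ k
  refine (hM.minTrPos_le hρ y hW).trans ?_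
  have hl : (0 : ℝ) < 2 ^ (-cA * k) := by positivity
  have hm : (0 : ℝ) < 2 ^ (-cB * k) := by positivity
  refine (hWm.trPos_le hs ht hl hm (by positivity) ?_).trans (le_of_eq ?_)
  · rw [blockLen_eq, ← Real.rpow_add two_pos]
    nth_rewrite 1 [← Real.rpow_one 2]
    rw [← Real.rpow_add two_pos]
    apply Real.rpow_le_rpow_of_exponent_le one_le_two
    push_cast
    linarith
  · rw [mul_pow, mul_pow, ← Real.rpow_mul two_pos.le, ← Real.rpow_mul two_pos.le,
      ← Real.rpow_natCast (2 ^ (-cB * t)), ← Real.rpow_natCast (2 ^ (cA * s)),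
      ← Real.rpow_mul two_pos.le, ← Real.rpow_mul two_pos.le,
      show -cB * (k : ℝ) * t = -cB * t * k by ring, show -cA * (k : ℝ) * -s = cA * s * k by ring]
    ring

/-- Above the regularized relative entropy the optimal value tends to zero. -/
lemma GoodFamily.tendsto_minTrPos (hM : GoodFamily σ M) (hρ : IsState ρ) {E : ℝ}
    (hE : Tendsto (fun n : ℕ => EMset (M n) (tpow ρ n) / n) atTop (nhds E)) {y : ℝ} (hy : E < y) :
    Tendsto (minTrPos M ρ y) atTop (nhds 0) := by
  obtain ⟨m, hm, hm0⟩ := ((hE.eventually (Iio_mem_nhds hy)).and (eventually_gt_atTop 0)).exists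
  have hm0' : (0 : ℝ) < m := by exact_mod_cast hm0
  obtain ⟨x, ⟨ω, hω, hsupp, rfl⟩, hlt⟩ := exists_lt_of_csInf_lt
    (by exact ⟨_, tpow σ m, hM.sigma_mem m, hM.suppLe_sigma m _, rfl⟩)
    ((div_lt_iff₀ hm0').mp (Set.mem_Iio.mp hm))
  have hblock := hM.tendsto_minTrPos_blockLen hρ hω hsupp hlt
  rw [Metric.tendsto_atTop]
  intro ε hε
  choose K hK using fun r => Metric.tendsto_atTop.mp (hblock r) ε hε
  refine ⟨(∑ r ∈ Finset.range m, K r) * m, fun n hn => ?_⟩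
  have hr : K (n % m) ≤ n / m :=
    (Finset.single_le_sum (fun r _ => Nat.zero_le (K r))
      (Finset.mem_range.mpr (Nat.mod_lt n hm0))).trans ((Nat.le_div_iff_mul_le hm0).mpr hn)
  have := hK (n % m) (n / m) hr
  rwa [blockLen_eq, mul_comm, Nat.mod_add_div] at this

end Family

section OperatorMonotone

open scoped MatrixOrder Matrix.Norms.L2Operator

lemma udiag_exp {U : Matrix I I ℂ} (hU : Uᴴ * U = 1) (g : I → ℝ) :
    NormedSpace.exp (udiag U g) = udiag U (fun i => Real.exp (g i)) := by
  have hinv : U⁻¹ = Uᴴ := inv_eq_left_inv hU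
  have hunit : IsUnit U := IsUnit.of_mul_eq_one Uᴴ (mul_eq_one_comm.mp hU)
  rw [udiag, udiag, ← hinv, exp_conj _ _ hunit, exp_diagonal]
  congr 3
  ext i
  rw [Pi.coe_exp, ← Complex.exp_eq_exp_ℂ, Complex.ofReal_exp]

/-- The logarithm is operator monotone. -/
lemma udiag_logb_mono {U V : Matrix I I ℂ} {p q : I → ℝ} (hU : Uᴴ * U = 1) (hV : Vᴴ * V = 1)
    (hp : ∀ i, 0 < p i) (hq : ∀ i, 0 < q i) (h : (udiag V q - udiag U p).PosSemidef) :
    (udiag V (fun i => Real.logb 2 (q i)) - udiag U (fun i => Real.logb 2 (p i))).PosSemidef := by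
  have key : ∀ {W : Matrix I I ℂ} {g : I → ℝ}, Wᴴ * W = 1 → (∀ i, 0 < g i) →
      CFC.log (udiag W g) = udiag W (fun i => Real.log (g i)) := by
    intro W g hW hg
    have : udiag W g = NormedSpace.exp (udiag W (fun i => Real.log (g i))) := by
      rw [udiag_exp hW]
      congr 1
      ext i
      rw [Real.exp_log (hg i)]
    rw [this, CFC.log_exp _ (udiag_conjTranspose W _)]
  have hpos : IsStrictlyPositive (udiag U p) := by
    rw [Matrix.isStrictlyPositive_iff_posDef]
    refine (PosDef.diagonal (d := fun i => (p i : ℂ)) fun i => by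
      exact_mod_cast hp i).mul_mul_conjTranspose_same ?_
    exact vecMul_injective_of_isUnit (IsUnit.of_mul_eq_one Uᴴ (mul_eq_one_comm.mp hU))
  have hle := CFC.log_le_log (Matrix.le_iff.mpr h) hpos
  rw [key hU hp, key hV hq, Matrix.le_iff] at hle
  have := posSemidef_real_smul hle (inv_nonneg.mpr (Real.log_pos one_lt_two).le)
  rw [smul_sub, ← udiag_smul, ← udiag_smul] at this
  simpa only [Real.logb, div_eq_inv_mul] using this

/-- If `A ≤ B + X` with `B` positive definite, then some `T` brings `A` below `B`, at a cost
controlled by `tr X`. -/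
lemma exists_smoothing {A B X : Matrix I I ℂ} (hB : B.PosDef) (hX : X.PosSemidef)
    (h : (B + X - A).PosSemidef) :
    ∃ T : Matrix I I ℂ, (B - T * A * Tᴴ).PosSemidef ∧
      ((1 - T) * A * (1 - T)ᴴ).trace.re ≤ X.trace.re := by
  have hD : (B + X).PosDef := hB.add_posSemidef hX
  set S := CFC.sqrt B
  set R := CFC.sqrt (B + X)
  have hS : S.PosSemidef := Matrix.nonneg_iff_posSemidef.mp (CFC.sqrt_nonneg B)
  have hR : R.PosSemidef := Matrix.nonneg_iff_posSemidef.mp (CFC.sqrt_nonneg (B + X))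
  have hSS : S * S = B :=
    CFC.sqrt_mul_sqrt_self B (Matrix.nonneg_iff_posSemidef.mpr hB.posSemidef)
  have hRR : R * R = B + X :=
    CFC.sqrt_mul_sqrt_self (B + X) (Matrix.nonneg_iff_posSemidef.mpr hD.posSemidef)
  have hSR : (R - S).PosSemidef := Matrix.le_iff.mp
    (CFC.sqrt_le_sqrt B (B + X) (Matrix.le_iff.mpr (by simpa using hX)))
  have hdet : IsUnit R.det := by
    have := hD.isUnit
    rw [← hRR, isUnit_iff_isUnit_det, det_mul] at this
    exact isUnit_of_mul_isUnit_left this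
  have hconj : ∀ Q : Matrix I I ℂ, Qᴴ = Q →
      (Q * R⁻¹) * (B + X) * (Q * R⁻¹)ᴴ = Q * Q := by
    intro Q hQ
    rw [conjTranspose_mul, hQ, conjTranspose_nonsing_inv, hR.isHermitian.eq, ← hRR]
    simp only [Matrix.mul_assoc]
    rw [← Matrix.mul_assoc R R⁻¹ Q, mul_nonsing_inv _ hdet, Matrix.one_mul,
      ← Matrix.mul_assoc R⁻¹ R Q, nonsing_inv_mul _ hdet, Matrix.one_mul]
  have hle : ∀ Q : Matrix I I ℂ, (Q * (B + X) * Qᴴ - Q * A * Qᴴ).PosSemidef := by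
    intro Q
    have := h.mul_mul_conjTranspose_same Q
    rwa [Matrix.mul_sub, Matrix.sub_mul] at this
  refine ⟨S * R⁻¹, ?_, ?_⟩
  · have := hle (S * R⁻¹)
    rwa [hconj S hS.isHermitian.eq, hSS] at this
  · have h1 : 1 - S * R⁻¹ = (R - S) * R⁻¹ := by
      rw [Matrix.sub_mul, mul_nonsing_inv _ hdet]
    have h2 := trace_le_of_le (hle ((R - S) * R⁻¹))
    rw [hconj (R - S) hSR.isHermitian.eq] at h2
    rw [h1]
    refine h2.trans ?_
    have h3 := trace_mul_le_of_le hSR hS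
    have h4 : (S * R).trace = (R * S).trace := trace_mul_comm S R
    rw [Matrix.mul_sub, Matrix.sub_mul, Matrix.sub_mul, hRR, hSS]
    rw [hSS] at h3
    simp only [trace_sub, trace_add, Complex.sub_re, Complex.add_re, h4]
    linarith

end OperatorMonotone

/-- Klein's inequality. -/
lemma klein_inequality {V U : Matrix I I ℂ} {r t : I → ℝ} (hV : Vᴴ * V = 1) (hU : Uᴴ * U = 1)
    (hr : ∀ i, 0 ≤ r i) (ht : ∀ j, 0 ≤ t j) (h0 : ∀ j, t j = 0 → wt (udiag V r) U j = 0) :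
    (∑ i, r i - ∑ j, t j) / Real.log 2 ≤
      ∑ i, Real.logb 2 (r i) * r i - ∑ j, Real.logb 2 (t j) * wt (udiag V r) U j := by
  set p : I → I → ℝ := fun i j => Complex.normSq ((Uᴴ * V) j i) with hp
  have hlog : 0 < Real.log 2 := Real.log_pos one_lt_two
  have hwt : ∀ j, wt (udiag V r) U j = ∑ i, r i * p i j := by
    intro j
    have : Uᴴ * udiag V r * U = (Uᴴ * V) * diagonal (fun i => (r i : ℂ)) * (Uᴴ * V)ᴴ := by
      simp [udiag, Matrix.mul_assoc]
    rw [wt, this, mul_apply, Complex.re_sum]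
    refine Finset.sum_congr rfl fun i _ => ?_
    rw [mul_diagonal, conjTranspose_apply, mul_right_comm, Complex.star_def, Complex.mul_conj,
      ← Complex.ofReal_mul, Complex.ofReal_re, mul_comm]
  have hcol : ∀ j, ∑ i, p i j = 1 := by
    intro j
    have h1 : (Uᴴ * V) * (Uᴴ * V)ᴴ = 1 := by
      rw [conjTranspose_mul, conjTranspose_conjTranspose, Matrix.mul_assoc, ← Matrix.mul_assoc V,
        mul_eq_one_comm.mp hV, Matrix.one_mul, hU]
    have h2 := congrArg (fun A : Matrix I I ℂ => (A j j).re) h1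
    simp only [mul_apply (M := Uᴴ * V), Complex.re_sum, one_apply_eq, Complex.one_re] at h2
    rw [← h2]
    refine Finset.sum_congr rfl fun i _ => ?_
    rw [conjTranspose_apply, Complex.star_def, Complex.mul_conj, Complex.ofReal_re]
  have hrow : ∀ i, ∑ j, p i j = 1 := by
    intro i
    have h1 : (Uᴴ * V)ᴴ * (Uᴴ * V) = 1 := by
      rw [conjTranspose_mul, conjTranspose_conjTranspose, Matrix.mul_assoc, ← Matrix.mul_assoc U,
        mul_eq_one_comm.mp hU, Matrix.one_mul, hV]
    have h2 := congrArg (fun A : Matrix I I ℂ => (A i i).re) h1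
    simp only [mul_apply (M := (Uᴴ * V)ᴴ), Complex.re_sum, one_apply_eq, Complex.one_re] at h2
    rw [← h2]
    refine Finset.sum_congr rfl fun j _ => ?_
    rw [conjTranspose_apply, Complex.star_def, mul_comm, Complex.mul_conj, Complex.ofReal_re]
  have hleft : (∑ i, r i - ∑ j, t j) / Real.log 2 =
      ∑ j, ∑ i, p i j * ((r i - t j) / Real.log 2) := by
    have e1 : ∑ i, r i = ∑ j, ∑ i, p i j * r i := by
      rw [Finset.sum_comm]
      exact Finset.sum_congr rfl fun i _ => by rw [← Finset.sum_mul, hrow, one_mul]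
    have e2 : ∑ j, t j = ∑ j, ∑ i, p i j * t j :=
      Finset.sum_congr rfl fun j _ => by rw [← Finset.sum_mul, hcol, one_mul]
    rw [e1, e2, ← Finset.sum_sub_distrib, Finset.sum_div]
    refine Finset.sum_congr rfl fun j _ => ?_
    rw [← Finset.sum_sub_distrib, Finset.sum_div]
    exact Finset.sum_congr rfl fun i _ => by ring
  have hright : ∑ i, Real.logb 2 (r i) * r i - ∑ j, Real.logb 2 (t j) * wt (udiag V r) U j =
      ∑ j, ∑ i, p i j * (Real.logb 2 (r i) * r i - Real.logb 2 (t j) * r i) := by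
    have e1 : ∑ i, Real.logb 2 (r i) * r i = ∑ j, ∑ i, p i j * (Real.logb 2 (r i) * r i) := by
      rw [Finset.sum_comm]
      exact Finset.sum_congr rfl fun i _ => by rw [← Finset.sum_mul, hrow, one_mul]
    rw [e1, ← Finset.sum_sub_distrib]
    refine Finset.sum_congr rfl fun j _ => ?_
    rw [hwt, Finset.mul_sum, ← Finset.sum_sub_distrib]
    exact Finset.sum_congr rfl fun i _ => by ring
  rw [hleft, hright]
  refine Finset.sum_le_sum fun j _ => Finset.sum_le_sum fun i _ => ?_
  have hpij : 0 ≤ p i j := Complex.normSq_nonneg _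
  rcases (ht j).eq_or_lt with hj | hj
  · have hz : r i * p i j = 0 := by
      have := h0 j hj.symm
      rw [hwt] at this
      exact (Finset.sum_eq_zero_iff_of_nonneg fun i _ =>
        mul_nonneg (hr i) (Complex.normSq_nonneg _)).mp this i (Finset.mem_univ i)
    refine le_of_eq ?_
    rw [← hj]
    linear_combination (1 / Real.log 2 - Real.logb 2 (r i) + Real.logb 2 0) * hz
  · refine mul_le_mul_of_nonneg_left ?_ hpij
    rcases (hr i).eq_or_lt with hi | hi
    · rw [← hi]
      simp only [mul_zero, zero_sub, sub_zero]
      exact div_nonpos_of_nonpos_of_nonneg (by linarith) hlog.le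
    · have h1 := Real.log_le_sub_one_of_pos (div_pos hj hi)
      rw [Real.log_div hj.ne' hi.ne'] at h1
      have h2 : r i - t j ≤ (Real.log (r i) - Real.log (t j)) * r i := by
        have h3 := mul_le_mul_of_nonneg_right h1 hi.le
        rw [sub_mul (t j / r i), div_mul_cancel₀ _ hi.ne'] at h3
        linarith
      calc (r i - t j) / Real.log 2
          ≤ (Real.log (r i) - Real.log (t j)) * r i / Real.log 2 :=
            div_le_div_of_nonneg_right h2 hlog.le
        _ = _ := by
            simp only [Real.logb]
            ring

lemma sum_mul_wt_le {A B X Q : Matrix I I ℂ} {f : I → ℝ} {p k c : ℝ}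
    (h : (p • A + k • X - B).PosSemidef) (hX : X.PosSemidef) (hk : 0 ≤ k) (hQ : Qᴴ * Q = 1)
    (hf : ∀ j, 0 ≤ f j) (hfc : ∀ j, f j ≤ c) :
    ∑ j, f j * wt B Q j ≤ p * ∑ j, f j * wt A Q j + c * (k * X.trace.re) := by
  rw [← wt_sum X hQ, Finset.mul_sum, Finset.mul_sum, Finset.mul_sum, ← Finset.sum_add_distrib]
  refine Finset.sum_le_sum fun j _ => ?_
  have h1 : wt B Q j ≤ p * wt A Q j + k * wt X Q j := by
    refine (wt_mono h Q j).trans (le_of_eq ?_)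
    simp [wt, Matrix.mul_add, Matrix.add_mul]
  have h2 : f j * (k * wt X Q j) ≤ c * (k * wt X Q j) :=
    mul_le_mul_of_nonneg_right (hfc j) (mul_nonneg hk (wt_nonneg hX Q j))
  have h3 := mul_le_mul_of_nonneg_left h1 (hf j)
  linarith

lemma sum_logb_mul_le {R W : Matrix I I ℂ} {w : I → ℝ} {L δ : ℝ} (hR : R.PosSemidef)
    (hW : Wᴴ * W = 1) (hL : 0 < L) (hδ : 0 < δ) (hw : ∀ j, δ ≤ w j)
    (h : (L • udiag W w - R).PosSemidef) {V : Matrix I I ℂ} {r : I → ℝ} (hV : Vᴴ * V = 1)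
    (hr : ∀ i, 0 ≤ r i) (hRV : R = udiag V r) :
    ∑ i, Real.logb 2 (r i) * r i ≤
      Real.logb 2 (2 * L) * ∑ i, r i + ∑ j, Real.logb 2 (w j) * wt R W j := by
  have hw0 : ∀ j, 0 < w j := fun j => hδ.trans_le (hw j)
  have hle : (udiag W (fun j => 2 * L * w j) - udiag V (fun i => r i + L * δ)).PosSemidef := by
    have h1 : udiag V (fun _ => L * δ) = udiag W (fun _ => L * δ) := by
      have e : ∀ {Q : Matrix I I ℂ}, Qᴴ * Q = 1 → udiag Q (fun _ => L * δ) = (L * δ) • 1 := by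
        intro Q hQ
        rw [← udiag_one hQ, ← udiag_smul]
        simp
      rw [e hV, e hW]
    have h2 := udiag_sub_posSemidef W (f := fun _ => L * δ) (g := fun j => L * w j)
      fun j => mul_le_mul_of_nonneg_left (hw j) hL.le
    have h3 := h.add h2
    rw [udiag_add, h1, ← hRV]
    convert h3 using 1
    rw [← udiag_smul, sub_add_sub_comm, ← udiag_add]
    congr 2
    ext j
    ring
  have hlog := trace_mul_nonneg hR (udiag_logb_mono hV hW
    (fun i => add_pos_of_nonneg_of_pos (hr i) (mul_pos hL hδ))
    (fun j => mul_pos (mul_pos two_pos hL) (hw0 j)) hle)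
  rw [Matrix.mul_sub, trace_sub, Complex.sub_re, trace_mul_udiag, trace_mul_udiag, sub_nonneg]
    at hlog
  calc ∑ i, Real.logb 2 (r i) * r i
      ≤ ∑ i, Real.logb 2 (r i + L * δ) * wt R V i := by
        refine Finset.sum_le_sum fun i _ => ?_
        rw [hRV, wt_udiag_self hV]
        rcases (hr i).eq_or_lt with hi | hi
        · simp [← hi]
        · exact mul_le_mul_of_nonneg_right (Real.logb_le_logb_of_le one_lt_two hi
            (by linarith [mul_pos hL hδ])) hi.le
    _ ≤ _ := hlog
    _ = _ := by
        have : ∑ i, r i = ∑ j, wt R W j := by rw [wt_sum R hW, hRV, trace_udiag hV]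
        rw [this, Finset.mul_sum, ← Finset.sum_add_distrib]
        refine Finset.sum_congr rfl fun j _ => ?_
        rw [Real.logb_mul (mul_pos two_pos hL).ne' (hw0 j).ne', add_mul]

lemma smoothing_estimate {η z P Q g m HA LA LR GA GR : ℝ} (hη : 0 < η) (hη1 : η ≤ 1)
    (hz : z ≤ 2 * η) (hP1 : 1 ≤ (1 + η) * P + z) (hP2 : P ≤ 1 + η + z)
    (hg : 0 ≤ g) (hm : 0 ≤ m) (hGA : -GA ≤ -HA + 1) (hGm : -GA ≤ m)
    (hLA : -LA ≤ (1 + η) * -LR + g * z) (hGR : -GR ≤ (1 + η) * -GA + m * z)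
    (hLR : -2 ≤ Q * P + LR - GR) :
    HA - LA ≤ Q + 7 * η * |Q| + 5 + 7 * η * m + 2 * η * g := by
  have hQ : (1 + η) * P * Q ≤ Q + 7 * η * |Q| := by
    have h1 : |(1 + η) * P - 1| ≤ 7 * η := by
      rw [abs_le]
      constructor <;> nlinarith
    have h2 : ((1 + η) * P - 1) * Q ≤ 7 * η * |Q| :=
      (le_abs_self _).trans (by rw [abs_mul]; exact mul_le_mul_of_nonneg_right h1 (abs_nonneg Q))
    linarith
  have hgz : g * z ≤ g * (2 * η) := mul_le_mul_of_nonneg_left hz hg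
  have hmz : m * z ≤ m * (2 * η) := mul_le_mul_of_nonneg_left hz hm
  have hLR' : -LR ≤ Q * P + 2 - (1 + η) * GA + 2 * η * m := by linarith
  have h1 := mul_le_mul_of_nonneg_left hLR' (show 0 ≤ 1 + η by linarith)
  have h2 : (2 * η + η ^ 2) * -GA ≤ 3 * η * m :=
    (mul_le_mul_of_nonneg_left hGm (by positivity)).trans
      (mul_le_mul_of_nonneg_right (by nlinarith) hm)
  have h3 : 0 ≤ η * m * (1 - η) := mul_nonneg (mul_nonneg hη.le hm) (sub_nonneg.mpr hη1)
  linarith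

/-- If `A` exceeds `L • B` only slightly, then `S(A‖B)` is not much larger than `log₂ L`. -/
lemma relEnt_le_of_le_add {A B X : Matrix I I ℂ} {L η γ : ℝ} (hA : IsState A) (hB : IsState B)
    (hX : X.PosSemidef) (hL : 0 < L) (hγ : 0 < γ) (hBγ : (B - γ • 1).PosSemidef) (hη : 0 < η)
    (hη1 : η ≤ 1) (hXη : X.trace.re ≤ η ^ 2) (h : (L • B + X - A).PosSemidef) :
    relEnt A B ≤ Real.logb 2 (2 * L) + 7 * η * |Real.logb 2 (2 * L)| + 5 +
      7 * η * (Real.logb 2 (Fintype.card I) + 1) + 2 * η * (-Real.logb 2 γ) := by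
  obtain ⟨U, a, hU, ha, hAU, hmA⟩ := exists_udiag_of_posSemidef hA.1
  obtain ⟨W, w, hW, hw, hBW, hmB⟩ := exists_udiag_of_posSemidef hB.1
  have hγw : ∀ j, γ ≤ w j := fun j => by
    have h1 := wt_mono (A := γ • 1) (B := B) hBγ W j
    rw [hBW, wt_udiag_self hW, ← udiag_one hW, ← udiag_smul, wt_udiag_self hW, mul_one] at h1
    exact h1
  have hsa : ∑ i, a i = 1 := by rw [← trace_udiag hU, ← hAU, hA.2, Complex.one_re]
  have hsw : ∑ i, w i = 1 := by rw [← trace_udiag hW, ← hBW, hB.2, Complex.one_re]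
  have ha1 : ∀ i, a i ≤ 1 := fun i => by
    rw [← hsa]
    exact Finset.single_le_sum (fun j _ => ha j) (Finset.mem_univ i)
  have hw1 : ∀ i, w i ≤ 1 := fun i => by
    rw [← hsw]
    exact Finset.single_le_sum (fun j _ => hw j) (Finset.mem_univ i)
  have hne : Nonempty I := by
    by_contra hne
    rw [not_nonempty_iff] at hne
    simp at hsa
  have hcard : (1 : ℝ) ≤ Fintype.card I := by exact_mod_cast Fintype.card_pos
  set N : ℝ := (Fintype.card I : ℝ) with hN
  have hN0 : 0 < N := by linarith
  obtain ⟨T, hT, hTX⟩ := exists_smoothing (A := A) (B := L • B) (X := X) (by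
    have h1 : (γ • (1 : Matrix I I ℂ)).PosDef := PosDef.one.smul hγ
    have h2 := h1.add_posSemidef hBγ
    rw [add_sub_cancel] at h2
    exact h2.smul hL) hX h
  set R := T * A * Tᴴ
  set Y := (1 - T) * A * (1 - T)ᴴ
  have hR : R.PosSemidef := hA.1.mul_mul_conjTranspose_same T
  have hY : Y.PosSemidef := hA.1.mul_mul_conjTranspose_same (1 - T)
  obtain ⟨V, r, hV, hr, hRV, _⟩ := exists_udiag_of_posSemidef hR
  have hAR : ((1 + η) • R + (1 + η⁻¹) • Y - A).PosSemidef := by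
    have h1 := conj_add_le hA.1 T (1 - T) hη
    rwa [add_sub_cancel, conjTranspose_one, Matrix.one_mul, Matrix.mul_one] at h1
  have hRA : ((1 + η) • A + (1 + η⁻¹) • Y - R).PosSemidef := by
    have h1 := conj_add_le hA.1 1 (T - 1) hη
    have h2 : (T - 1) * A * (T - 1)ᴴ = Y := by
      rw [← neg_sub 1 T, conjTranspose_neg, Matrix.neg_mul, Matrix.neg_mul, Matrix.mul_neg, neg_neg]
    rwa [h2, add_sub_cancel, conjTranspose_one, Matrix.one_mul, Matrix.mul_one] at h1
  have hk : 0 ≤ 1 + η⁻¹ := by positivity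
  have hYη : (1 + η⁻¹) * Y.trace.re ≤ 2 * η := by
    calc (1 + η⁻¹) * Y.trace.re ≤ (1 + η⁻¹) * η ^ 2 :=
          mul_le_mul_of_nonneg_left (hTX.trans hXη) hk
      _ = η ^ 2 + η := by field_simp
      _ ≤ 2 * η := by nlinarith
  have hAtr : ∑ j, (1 : ℝ) * wt A U j = 1 := by simp [wt_sum A hU, hA.2]
  have hRtr : ∑ j, (1 : ℝ) * wt R U j = ∑ i, r i := by
    simp [wt_sum R hU]
    rw [hRV, trace_udiag hV]
  have hP1 := sum_mul_wt_le hAR hY hk hU (f := fun _ => 1) (c := 1) (fun _ => zero_le_one)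
    (fun _ => le_rfl)
  have hP2 := sum_mul_wt_le hRA hY hk hU (f := fun _ => 1) (c := 1) (fun _ => zero_le_one)
    (fun _ => le_rfl)
  rw [hAtr, hRtr] at hP1 hP2
  have hP0 : 0 ≤ ∑ i, r i := Finset.sum_nonneg fun i _ => hr i
  have hop := sum_logb_mul_le hR hW hL hγ hγw (by rw [← hBW]; exact hT) hV hr hRV
  have hLog := sum_mul_wt_le hAR hY hk hW (f := fun j => -Real.logb 2 (w j))
    (c := -Real.logb 2 γ)
    (fun j => neg_nonneg.mpr (Real.logb_nonpos one_lt_two (hw j) (hw1 j)))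
    (fun j => neg_le_neg (Real.logb_le_logb_of_le one_lt_two hγ (hγw j)))
  set q : I → ℝ := fun i => (a i + N⁻¹) / 2 with hq
  have hq0 : ∀ i, 0 < q i := fun i => by
    have := ha i
    positivity
  have hNinv : N⁻¹ ≤ 1 := inv_le_one_of_one_le₀ hcard
  have hqsum : ∑ i, q i = 1 := by
    rw [hq, ← Finset.sum_div, Finset.sum_add_distrib, hsa, Finset.sum_const, Finset.card_univ,
      nsmul_eq_mul, ← hN, mul_inv_cancel₀ hN0.ne']
    norm_num
  have hqN : ∀ i, -Real.logb 2 (q i) ≤ Real.logb 2 N + 1 := fun i => by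
    have h1 : Real.logb 2 (N⁻¹ / 2) ≤ Real.logb 2 (q i) :=
      Real.logb_le_logb_of_le one_lt_two (by positivity) (by simp only [hq]; linarith [ha i])
    rw [Real.logb_div (by positivity) two_ne_zero, Real.logb_inv,
      Real.logb_self_eq_one one_lt_two] at h1
    linarith
  have hqa : ∀ i, -Real.logb 2 (q i) * a i ≤ -(Real.logb 2 (a i) * a i) + a i := fun i => by
    rcases (ha i).eq_or_lt with hi | hi
    · simp [← hi]
    · have h1 : Real.logb 2 (a i / 2) ≤ Real.logb 2 (q i) :=
        Real.logb_le_logb_of_le one_lt_two (by positivity)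
          (by simp only [hq]; linarith [inv_pos.mpr hN0])
      rw [Real.logb_div hi.ne' two_ne_zero, Real.logb_self_eq_one one_lt_two] at h1
      nlinarith
  have hG := sum_mul_wt_le hRA hY hk hU (f := fun j => -Real.logb 2 (q j))
    (c := Real.logb 2 N + 1)
    (fun j => neg_nonneg.mpr (Real.logb_nonpos one_lt_two (hq0 j).le
      (by simp only [hq]; linarith [ha1 j]))) hqN
  have hklein := klein_inequality hV hU hr (fun j => (hq0 j).le)
    (fun j hj => absurd hj (hq0 j).ne')
  rw [← hRV, hqsum] at hklein
  have hlog2 : -2 ≤ (∑ i, r i - 1) / Real.log 2 := by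
    have := Real.log_two_gt_d9
    rw [le_div_iff₀ (by linarith)]
    linarith
  have hwtA : ∀ i, wt A U i = a i := fun i => by rw [hAU, wt_udiag_self hU]
  have hGa : ∑ j, -Real.logb 2 (q j) * wt A U j ≤ -∑ i, Real.logb 2 (a i) * a i + 1 := by
    rw [← hsa, ← Finset.sum_neg_distrib, ← Finset.sum_add_distrib]
    exact Finset.sum_le_sum fun i _ => by rw [hwtA]; exact hqa i
  have hGN : ∑ j, -Real.logb 2 (q j) * wt A U j ≤ Real.logb 2 N + 1 := by
    have h1 : Real.logb 2 N + 1 = ∑ i, (Real.logb 2 N + 1) * a i := by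
      rw [← Finset.mul_sum, hsa, mul_one]
    rw [h1]
    exact Finset.sum_le_sum fun i _ => by
      rw [hwtA]
      exact mul_le_mul_of_nonneg_right (hqN i) (ha i)
  have hN1 : 0 ≤ Real.logb 2 N := Real.logb_nonneg one_lt_two hcard
  have hg0 : 0 ≤ -Real.logb 2 γ := by
    obtain ⟨i⟩ := hne
    exact neg_nonneg.mpr (Real.logb_nonpos one_lt_two hγ.le ((hγw i).trans (hw1 i)))
  rw [relEnt_udiag hU hAU hmA hmB]
  generalize -Real.logb 2 γ = g at hLog hg0 ⊢
  simp only [neg_mul, Finset.sum_neg_distrib] at hLog hG hGa hGN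
  exact smoothing_estimate hη hη1 hYη (by linarith) (by linarith)
    hg0 (add_nonneg hN1 zero_le_one) hGa hGN hLog hG
    (hklein.trans (sub_le_sub_right hop _) |> hlog2.trans)

lemma relEnt_nonneg {A B : Matrix I I ℂ} (hA : IsState A) (hB : IsState B) (h : SuppLe A B) :
    0 ≤ relEnt A B := by
  obtain ⟨U, a, hU, ha, rfl, hmA⟩ := exists_udiag_of_posSemidef hA.1
  obtain ⟨W, w, hW, hw, rfl, hmB⟩ := exists_udiag_of_posSemidef hB.1
  have hk := klein_inequality hU hW ha hw fun j => wt_eq_zero_of_suppLe hW h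
  rw [← trace_udiag hU, ← trace_udiag hW, hA.2, hB.2, sub_self, zero_div] at hk
  rwa [relEnt_udiag hU rfl hmA hmB]

section Family

variable {d : ℕ} {σ ρ : Matrix (Fin d) (Fin d) ℂ}
  {M : ∀ n : ℕ, Set (Matrix (Fin n → Fin d) (Fin n → Fin d) ℂ)}

lemma GoodFamily.EMset_le (hM : GoodFamily σ M) (hρ : IsState ρ) {n : ℕ}
    {ω : Matrix (Fin n → Fin d) (Fin n → Fin d) ℂ} (hω : ω ∈ M n) (h : SuppLe (tpow ρ n) ω) :
    EMset (M n) (tpow ρ n) ≤ relEnt (tpow ρ n) ω := by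
  refine csInf_le ⟨0, ?_⟩ ⟨ω, hω, h, rfl⟩
  rintro x ⟨ν, hν, hsupp, rfl⟩
  exact relEnt_nonneg (hρ.tpow n) (hM.states n ν hν) hsupp

lemma GoodFamily.minTrPos_le_one (hM : GoodFamily σ M) (hρ : IsState ρ) (y : ℝ) (n : ℕ) :
    minTrPos M ρ y n ≤ 1 := by
  refine (hM.minTrPos_le hρ y (hM.sigma_mem n)).trans ?_
  have h1 := trPos_le (hM.isHermitian_sub hρ (hM.sigma_mem n) (2 ^ (y * n))) (hρ.tpow n).1 (by
    rw [sub_sub_cancel]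
    exact posSemidef_real_smul (hM.sigma_state.tpow n).1 (by positivity))
  rwa [(hρ.tpow n).2, Complex.one_re] at h1

/-- A small optimal value at rate `y` bounds the relative entropy to `M n` by about `y n`. -/
lemma GoodFamily.exists_EMset_le (hM : GoodFamily σ M) (hρ : IsState ρ) (y : ℝ) :
    ∃ C : ℝ, 0 ≤ C ∧ ∀ (n : ℕ) (η : ℝ), 0 < η → η ≤ 1 → minTrPos M ρ y n < η ^ 2 →
      EMset (M n) (tpow ρ n) ≤ y * n + η * C * n + 30 := by
  obtain ⟨c, hc, hc1, hcn⟩ := exists_tpow_lower_bound hM.sigma_state hM.sigma_posdef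
  have hlogc : Real.logb 2 c ≤ 0 := Real.logb_nonpos one_lt_two hc.le hc1
  have hlogd : 0 ≤ Real.logb 2 d := by
    rcases Nat.eq_zero_or_pos d with hd | hd
    · simp [hd]
    · exact Real.logb_nonneg one_lt_two (by exact_mod_cast hd)
  refine ⟨7 * |y| + 7 * Real.logb 2 d + 2 * -Real.logb 2 c, ?_, fun n η hη hη1 hlt => ?_⟩
  · linarith [abs_nonneg y]
  obtain ⟨x, ⟨ω, hω, rfl⟩, hx⟩ :=
    exists_lt_of_csInf_lt (by exact ⟨_, tpow σ n, hM.sigma_mem n, rfl⟩) hlt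
  obtain ⟨X, hX, hXle, hXtr⟩ := exists_posPart (hM.isHermitian_sub hρ hω (2 ^ (y * n)))
  have hν : (2⁻¹ : ℝ) • ω + (2⁻¹ : ℝ) • tpow σ n ∈ M n :=
    hM.convex n hω (hM.sigma_mem n) (by norm_num) (by norm_num) (by norm_num)
  set ν := (2⁻¹ : ℝ) • ω + (2⁻¹ : ℝ) • tpow σ n with hν_def
  have hγ : 0 < 2⁻¹ * c ^ n := by positivity
  have hνγ : (ν - (2⁻¹ * c ^ n) • 1).PosSemidef := by
    have h1 := (posSemidef_real_smul (hM.states n ω hω).1 (c := 2⁻¹) (by norm_num)).add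
      (posSemidef_real_smul (hcn n) (c := 2⁻¹) (by norm_num))
    rwa [smul_sub, smul_smul, ← add_sub_assoc] at h1
  have hle : ((2 ^ (y * n) * 2 : ℝ) • ν + X - tpow ρ n).PosSemidef := by
    have h1 := hXle.add (posSemidef_real_smul (hM.sigma_state.tpow n).1
      (c := 2 ^ (y * n)) (by positivity))
    convert h1 using 1
    rw [hν_def, smul_add, smul_smul, smul_smul, mul_inv_cancel_right₀ two_ne_zero]
    abel
  have hrel := relEnt_le_of_le_add (hρ.tpow n) (hM.states n ν hν) hX (by positivity) hγ hνγ hη hη1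
    (hXtr.trans_lt hx).le hle
  have hlogL : Real.logb 2 (2 * (2 ^ (y * n) * 2)) = y * n + 2 := by
    rw [show (2 : ℝ) * (2 ^ (y * n) * 2) = 2 ^ (y * n) * 2 ^ (2 : ℝ) by norm_num; ring,
      ← Real.rpow_add two_pos, Real.logb_rpow two_pos (by norm_num)]
  have hcard : Real.logb 2 (Fintype.card (Fin n → Fin d)) = n * Real.logb 2 d := by
    simp [Real.logb_pow]
  have hlogγ : Real.logb 2 (2⁻¹ * c ^ n) = -1 + n * Real.logb 2 c := by
    rw [Real.logb_mul (by norm_num) (pow_pos hc n).ne', Real.logb_inv,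
      Real.logb_self_eq_one one_lt_two, Real.logb_pow]
  rw [hlogL, hcard, hlogγ] at hrel
  refine ((hM.EMset_le hρ hν (suppLe_of_lower_bound hγ hνγ)).trans hrel).trans ?_
  have habs : |y * n + 2| ≤ |y| * n + 2 := by
    refine (abs_add_le _ _).trans (le_of_eq ?_)
    rw [abs_mul, Nat.abs_cast, abs_two]
  have h1 := mul_le_mul_of_nonneg_left habs (show 0 ≤ 7 * η by linarith)
  linarith

/-- Below the regularized relative entropy the optimal value stays away from zero. -/
lemma GoodFamily.liminf_minTrPos_pos (hM : GoodFamily σ M) (hρ : IsState ρ) {E : ℝ}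
    (hE : Tendsto (fun n : ℕ => EMset (M n) (tpow ρ n) / n) atTop (nhds E)) {y : ℝ} (hy : y < E) :
    0 < liminf (minTrPos M ρ y) atTop := by
  obtain ⟨C, hC, hbound⟩ := hM.exists_EMset_le hρ y
  set e := E - y with he
  have he0 : 0 < e := sub_pos.mpr hy
  set η := min 1 (e / (4 * (C + 1))) with hη
  have hη0 : 0 < η := lt_min one_pos (by positivity)
  have hηC : η * C ≤ e / 4 := by
    have h1 : η * (4 * (C + 1)) ≤ e := (le_div_iff₀ (by positivity)).mp (min_le_right _ _)
    linarith
  have hev : ∀ᶠ n : ℕ in atTop, η ^ 2 ≤ minTrPos M ρ y n := by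
    filter_upwards [hE.eventually (lt_mem_nhds (show E - e / 4 < E by linarith)),
      eventually_gt_atTop 0,
      (tendsto_natCast_atTop_atTop.atTop_mul_const he0).eventually_ge_atTop (120 : ℝ)]
      with n hn hn0 hn1
    by_contra! hlt
    have h1 := hbound n η hη0 (min_le_left _ _) hlt
    have hn0' : (0 : ℝ) < n := by exact_mod_cast hn0
    rw [lt_div_iff₀ hn0'] at hn
    have h2 : η * C * n ≤ e / 4 * n := mul_le_mul_of_nonneg_right hηC hn0'.le
    nlinarith
  refine (pow_pos hη0 2).trans_le (le_liminf_of_le ?_ hev)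
  exact (isBoundedUnder_of ⟨1, hM.minTrPos_le_one hρ y⟩).isCoboundedUnder_ge

end Family

end StrongConverse

/-- **Corollary (strong converse form).**  For a family `{M n}` satisfying properties
1–5 and a state `ρ` with `E = E_M^∞(ρ)`: `min_{ω ∈ M n} tr(ρ^{⊗n} − 2^{yn} ω)₊ → 0`
for every `y > E`, while its liminf is strictly positive for every `y < E`. -/
theorem main_compact_strong_converse {d : ℕ} (σ : Matrix (Fin d) (Fin d) ℂ)
    (M : ∀ n : ℕ, Set (Matrix (Fin n → Fin d) (Fin n → Fin d) ℂ))
    (hM : GoodFamily σ M)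
    (ρ : Matrix (Fin d) (Fin d) ℂ) (hρ : IsState ρ)
    (E : ℝ)
    (hE : Filter.Tendsto (fun n : ℕ => EMset (M n) (tpow ρ n) / n) Filter.atTop (nhds E)) :
    (∀ y : ℝ, E < y →
      Filter.Tendsto (fun n : ℕ =>
          sInf {x : ℝ | ∃ ω ∈ M n, x = trPos (tpow ρ n - ((2:ℝ) ^ (y * (n:ℝ))) • ω)})
        Filter.atTop (nhds 0)) ∧
    (∀ y : ℝ, y < E →
      0 < Filter.liminf (fun n : ℕ =>
          sInf {x : ℝ | ∃ ω ∈ M n, x = trPos (tpow ρ n - ((2:ℝ) ^ (y * (n:ℝ))) • ω)})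
        Filter.atTop) := by
  exact ⟨fun y hy => hM.tendsto_minTrPos hρ hE hy, fun y hy => hM.liminf_minTrPos_pos hρ hE hy⟩

end GQSL
end
end

section
/- The regularized relative entropy of entanglement is faithful: for every entangled state ρ on a finite-dimensional multipartite Hilbert space ℋ_1 ⊗ … ⊗ ℋ_k, one has E_R^∞(ρ) > 0. -/
open scoped BigOperators
open Filter ComplexOrder

noncomputable section

namespace GQSL

variable {I : Type*} [Fintype I] [DecidableEq I]

section RelativeEntropy

theorem fcal_of_isHermitian (f : ℝ → ℝ) {A : Matrix I I ℂ} (hA : A.IsHermitian) :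
    fcal f A = (hA.eigenvectorUnitary : Matrix I I ℂ) *
      Matrix.diagonal (fun i => (f (hA.eigenvalues i) : ℂ)) *
      star (hA.eigenvectorUnitary : Matrix I I ℂ) := by
  rw [fcal, dif_pos hA]

theorem fcal_id {A : Matrix I I ℂ} (hA : A.IsHermitian) : fcal (fun x => x) A = A := by
  rw [fcal_of_isHermitian _ hA]
  conv_rhs => rw [hA.spectral_theorem, Unitary.conjStarAlgAut_apply]
  rfl

theorem fcal_one {A : Matrix I I ℂ} (hA : A.IsHermitian) : fcal (fun _ => 1) A = 1 := by
  rw [fcal_of_isHermitian _ hA]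
  simp

theorem fcal_mul_fcal (f g : ℝ → ℝ) {A : Matrix I I ℂ} (hA : A.IsHermitian) :
    fcal f A * fcal g A = fcal (fun x => f x * g x) A := by
  simp only [fcal_of_isHermitian _ hA]
  set U := (hA.eigenvectorUnitary : Matrix I I ℂ)
  have hU : star U * U = 1 := Unitary.coe_star_mul_self hA.eigenvectorUnitary
  calc _ = U * Matrix.diagonal (fun i => (f (hA.eigenvalues i) : ℂ)) * (star U * U) *
        Matrix.diagonal (fun i => (g (hA.eigenvalues i) : ℂ)) * star U := by
        simp only [mul_assoc]
    _ = _ := by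
        rw [hU, mul_one, mul_assoc U, Matrix.diagonal_mul_diagonal]
        simp

theorem fcal_congr_eigenvalues {f g : ℝ → ℝ} {A : Matrix I I ℂ} (hA : A.IsHermitian)
    (h : ∀ i, f (hA.eigenvalues i) = g (hA.eigenvalues i)) : fcal f A = fcal g A := by
  simp only [fcal_of_isHermitian _ hA, h]

theorem isHermitian_fcal (f : ℝ → ℝ) (A : Matrix I I ℂ) : (fcal f A).IsHermitian := by
  by_cases hA : A.IsHermitian
  · rw [fcal_of_isHermitian _ hA, Matrix.star_eq_conjTranspose]
    refine Matrix.isHermitian_mul_mul_conjTranspose _ ?_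
    rw [Matrix.isHermitian_diagonal_iff]
    intro i
    simp [IsSelfAdjoint]
  · rw [fcal, dif_neg hA]
    exact Matrix.isHermitian_zero

theorem msqrt_mul_msqrt {A : Matrix I I ℂ} (hA : A.PosSemidef) : msqrt A * msqrt A = A := by
  rw [msqrt, fcal_mul_fcal _ _ hA.1]
  conv_rhs => rw [← fcal_id hA.1]
  exact fcal_congr_eigenvalues hA.1 fun i => Real.mul_self_sqrt (hA.eigenvalues_nonneg i)

/-- The squared overlaps between the eigenvectors of two Hermitian matrices. -/
def overlap {A B : Matrix I I ℂ} (hA : A.IsHermitian) (hB : B.IsHermitian) (i j : I) : ℝ :=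
  Complex.normSq ((star (hA.eigenvectorUnitary : Matrix I I ℂ) *
    (hB.eigenvectorUnitary : Matrix I I ℂ)) i j)

theorem re_trace_fcal_mul_fcal (f g : ℝ → ℝ) {A B : Matrix I I ℂ} (hA : A.IsHermitian)
    (hB : B.IsHermitian) :
    ((fcal f A * fcal g B).trace).re =
      ∑ i, ∑ j, overlap hA hB i j * (f (hA.eigenvalues i) * g (hB.eigenvalues j)) := by
  simp only [fcal_of_isHermitian _ hA, fcal_of_isHermitian _ hB, overlap]
  set U := (hA.eigenvectorUnitary : Matrix I I ℂ)
  set V := (hB.eigenvectorUnitary : Matrix I I ℂ)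
  set D := Matrix.diagonal (fun i => (f (hA.eigenvalues i) : ℂ)) with hD
  set E := Matrix.diagonal (fun i => (g (hB.eigenvalues i) : ℂ)) with hE
  have h1 : (U * D * star U * (V * E * star V)).trace =
      (D * (star U * V) * (E * star (star U * V))).trace := by
    rw [show U * D * star U * (V * E * star V) = U * (D * star U * (V * E * star V)) by
      simp only [mul_assoc], Matrix.trace_mul_comm]
    congr 1
    simp only [star_mul, star_star, mul_assoc]
  rw [h1]
  set W := star U * V
  simp only [Matrix.trace, Matrix.diag, Matrix.mul_apply (M := D * W), Complex.re_sum]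
  refine Finset.sum_congr rfl fun i _ => Finset.sum_congr rfl fun j _ => ?_
  rw [hD, hE, Matrix.diagonal_mul, Matrix.diagonal_mul, Matrix.star_apply]
  have : W i j * star (W i j) = (Complex.normSq (W i j) : ℂ) := Complex.mul_conj _
  rw [show (f (hA.eigenvalues i) : ℂ) * W i j * (g (hB.eigenvalues j) * star (W i j)) =
    (f (hA.eigenvalues i) : ℂ) * (g (hB.eigenvalues j)) * (W i j * star (W i j)) by ring, this,
    ← Complex.ofReal_mul, ← Complex.ofReal_mul, Complex.ofReal_re]
  ring

theorem overlap_nonneg {A B : Matrix I I ℂ} (hA : A.IsHermitian) (hB : B.IsHermitian) (i j : I) :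
    0 ≤ overlap hA hB i j := Complex.normSq_nonneg _

theorem overlap_mul_eigenvalue_eq_zero {ρ σ : Matrix I I ℂ} (hρ : ρ.PosSemidef)
    (hσ : σ.IsHermitian) (hs : SuppLe ρ σ) {j : I} (hj : hσ.eigenvalues j = 0) (i : I) :
    overlap hρ.1 hσ i j * hρ.1.eigenvalues i = 0 := by
  have hker : σ * fcal (fun x => if x = 0 then 1 else 0) σ = 0 := by
    nth_rewrite 1 [← fcal_id hσ]
    rw [fcal_mul_fcal _ _ hσ, fcal_congr_eigenvalues (g := fun _ => 0) hσ (by intro i; simp),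
      fcal_of_isHermitian _ hσ]
    simp
  have hzero : ρ * fcal (fun x => if x = 0 then 1 else 0) σ = 0 := by
    ext a b
    have h := congrFun (hs (fun c => fcal (fun x => if x = 0 then 1 else 0) σ c b) (by
      ext c
      exact congrFun (congrFun hker c) b)) a
    exact h
  have hsum := re_trace_fcal_mul_fcal (fun x => x) (fun x => if x = 0 then 1 else 0) hρ.1 hσ
  rw [fcal_id hρ.1, hzero, Matrix.trace_zero, Complex.zero_re] at hsum
  have hnn : ∀ i j, 0 ≤ overlap hρ.1 hσ i j *
      (hρ.1.eigenvalues i * if hσ.eigenvalues j = 0 then 1 else 0) := fun i j =>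
    mul_nonneg (overlap_nonneg _ _ _ _)
      (mul_nonneg (hρ.eigenvalues_nonneg i) (by split_ifs <;> norm_num))
  have h1 := (Finset.sum_eq_zero_iff_of_nonneg
    (fun i _ => Finset.sum_nonneg fun j _ => hnn i j)).1 hsum.symm i (Finset.mem_univ _)
  have h2 := (Finset.sum_eq_zero_iff_of_nonneg (fun j _ => hnn i j)).1 h1 j (Finset.mem_univ _)
  simpa [hj] using h2

theorem mul_log_sub_log_ge {l m β : ℝ} (hl : 0 < l) (hm : 0 < m) (hβ : 0 < β) :
    2 * (l - √l * √m / β) - 2 * l * Real.log β ≤ l * (Real.log l - Real.log m) := by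
  have hsl := Real.sqrt_pos.2 hl
  have hsm := Real.sqrt_pos.2 hm
  have h := Real.log_le_sub_one_of_pos (show 0 < √m / (√l * β) by positivity)
  rw [Real.log_div hsm.ne' (by positivity), Real.log_mul hsl.ne' hβ.ne',
    Real.log_sqrt hm.le, Real.log_sqrt hl.le] at h
  have h2 := mul_le_mul_of_nonneg_left h hl.le
  have h3 : l * (√m / (√l * β)) = √l * √m / β := by
    field_simp
    rw [Real.sq_sqrt hl.le]
  rw [mul_sub, mul_sub l (√m / _), h3] at h2
  linarith

/-- The relative entropy dominates the Petz–Rényi divergence of order one half. -/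
theorem neg_two_mul_logb_le_relEnt {ρ σ : Matrix I I ℂ} (hρ : IsState ρ) (hσ : σ.PosSemidef)
    (hs : SuppLe ρ σ) {β : ℝ} (hβ : 0 < β) (hle : ((msqrt ρ * msqrt σ).trace).re ≤ β) :
    -2 * Real.logb 2 β ≤ relEnt ρ σ := by
  obtain ⟨hρ, htr⟩ := hρ
  set w := overlap hρ.1 hσ.1
  set l := hρ.1.eigenvalues
  set m := hσ.1.eigenvalues
  let L : ℝ → ℝ := fun x => if 0 < x then Real.logb 2 x else 0
  have hone : ∑ i, ∑ j, w i j * l i = 1 := by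
    have := re_trace_fcal_mul_fcal (fun x => x) (fun _ => 1) hρ.1 hσ.1
    rw [fcal_id hρ.1, fcal_one hσ.1, mul_one, htr] at this
    simpa using this.symm
  have hsqrt : ∑ i, ∑ j, w i j * (√(l i) * √(m j)) ≤ β := by
    rwa [msqrt, msqrt, re_trace_fcal_mul_fcal _ _ hρ.1 hσ.1] at hle
  have hrel : relEnt ρ σ = ∑ i, ∑ j, w i j * (l i * (L (l i) - L (m j))) := by
    have h1 := re_trace_fcal_mul_fcal (fun x => x * L x) (fun _ => 1) hρ.1 hσ.1
    have h2 := re_trace_fcal_mul_fcal (fun x => x) L hρ.1 hσ.1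
    rw [← fcal_mul_fcal (fun x => x) L hρ.1, fcal_one hσ.1, mul_one, fcal_id hρ.1] at h1
    rw [fcal_id hρ.1] at h2
    rw [relEnt, mul_sub, Matrix.trace_sub, Complex.sub_re]
    change ((ρ * fcal L ρ).trace).re - ((ρ * fcal L σ).trace).re = _
    rw [h1, h2, ← Finset.sum_sub_distrib]
    refine Finset.sum_congr rfl fun i _ => ?_
    rw [← Finset.sum_sub_distrib]
    exact Finset.sum_congr rfl fun j _ => by ring
  have hlog2 : 0 < Real.log 2 := Real.log_pos (by norm_num)
  have hterm : ∀ i j, 2 * (w i j * l i - w i j * (√(l i) * √(m j)) / β)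
      - 2 * Real.log β * (w i j * l i) ≤
      Real.log 2 * (w i j * (l i * (L (l i) - L (m j)))) := by
    intro i j
    have hw : 0 ≤ w i j := overlap_nonneg _ _ _ _
    rcases (hρ.eigenvalues_nonneg i).eq_or_lt with h0 | hl
    · have h0' : l i = 0 := h0.symm
      simp [h0']
    rcases (hσ.eigenvalues_nonneg j).eq_or_lt with h0 | hm
    · have := overlap_mul_eigenvalue_eq_zero hρ hσ.1 hs h0.symm i
      have hw0 : w i j = 0 := (mul_eq_zero.1 this).resolve_right hl.ne'
      simp [hw0]
    · have hL : L (l i) - L (m j) = (Real.log (l i) - Real.log (m j)) / Real.log 2 := by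
        simp only [L, if_pos (show 0 < l i from hl), if_pos (show 0 < m j from hm), Real.logb]
        ring
      have h := mul_le_mul_of_nonneg_left (mul_log_sub_log_ge (β := β) hl hm hβ) hw
      rw [hL]
      calc _ = w i j * (2 * (l i - √(l i) * √(m j) / β) - 2 * l i * Real.log β) := by ring
        _ ≤ w i j * (l i * (Real.log (l i) - Real.log (m j))) := h
        _ = _ := by field_simp
  have hsum := Finset.sum_le_sum fun i (_ : i ∈ Finset.univ) =>
    Finset.sum_le_sum fun j (_ : j ∈ Finset.univ) => hterm i j
  simp only [Finset.sum_sub_distrib, ← Finset.mul_sum, ← Finset.sum_div, hone, ← hrel] at hsum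
  have hdiv := (div_le_one hβ).2 hsqrt
  rw [Real.logb, mul_div_assoc', div_le_iff₀ hlog2]
  linarith

end RelativeEntropy

section Measurement

variable {J X : Type*} [Fintype J] [Fintype X]

/-- The quadratic form `⟨v|A|v⟩` (its real part) of a matrix. -/
def qform (A : Matrix J J ℂ) (v : J → ℂ) : ℝ := (star v ⬝ᵥ A.mulVec v).re

theorem qform_nonneg {A : Matrix J J ℂ} (hA : A.PosSemidef) (v : J → ℂ) : 0 ≤ qform A v :=
  hA.re_dotProduct_nonneg v

theorem dotProduct_mulVec_eq_qform {A : Matrix J J ℂ} (hA : A.PosSemidef) (v : J → ℂ) :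
    star v ⬝ᵥ A.mulVec v = (qform A v : ℂ) :=
  (Complex.conj_eq_iff_re.1 (Complex.conj_eq_iff_im.2
    (Complex.nonneg_iff.1 (hA.dotProduct_mulVec_nonneg v)).2.symm)).symm

theorem qform_smul (s : ℝ) (A : Matrix J J ℂ) (v : J → ℂ) :
    qform (s • A) v = s * qform A v := by
  rw [qform, Matrix.smul_mulVec, dotProduct_smul, Complex.smul_re, smul_eq_mul, qform]

theorem qform_conjTranspose_mul_mul {J' : Type*} [Fintype J'] (A : Matrix J J ℂ)
    (K : Matrix J J' ℂ) (v : J' → ℂ) :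
    qform (K.conjTranspose * A * K) v = qform A (K.mulVec v) := by
  rw [qform, qform, ← Matrix.mulVec_mulVec, ← Matrix.mulVec_mulVec, Matrix.star_mulVec,
    Matrix.dotProduct_mulVec]

theorem continuous_qform (v : J → ℂ) : Continuous fun A : Matrix J J ℂ => qform A v := by
  unfold qform
  fun_prop

theorem re_dotProduct_mulVec_mul_le {R S : Matrix J J ℂ} (hR : R.IsHermitian)
    (hS : S.IsHermitian) (v : J → ℂ) :
    (star v ⬝ᵥ (R * S).mulVec v).re ≤ √(qform (R * R) v) * √(qform (S * S) v) := by
  have key : ∀ {P : Matrix J J ℂ}, P.IsHermitian → ∀ Q : Matrix J J ℂ,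
      star v ⬝ᵥ (P * Q).mulVec v = star (P.mulVec v) ⬝ᵥ Q.mulVec v := by
    intro P hP Q
    rw [Matrix.star_mulVec, hP.eq, ← Matrix.mulVec_mulVec, Matrix.dotProduct_mulVec]
  have hq : ∀ {P : Matrix J J ℂ}, P.IsHermitian →
      qform (P * P) v = ∑ a, ‖P.mulVec v a‖ ^ 2 := by
    intro P hP
    rw [qform, key hP, dotProduct, Complex.re_sum]
    refine Finset.sum_congr rfl fun a _ => ?_
    rw [Pi.star_apply, mul_comm, ← Complex.normSq_eq_norm_sq]
    change (P.mulVec v a * (starRingEnd ℂ) (P.mulVec v a)).re = _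
    rw [Complex.mul_conj, Complex.ofReal_re]
  rw [key hR, hq hR, hq hS]
  calc _ ≤ ‖star (R.mulVec v) ⬝ᵥ S.mulVec v‖ := Complex.re_le_norm _
    _ ≤ ∑ a, ‖R.mulVec v a‖ * ‖S.mulVec v a‖ := by
        refine (norm_sum_le _ _).trans (le_of_eq ?_)
        exact Finset.sum_congr rfl fun a _ => by rw [norm_mul, Pi.star_apply, norm_star]
    _ ≤ _ := Real.sum_mul_le_sqrt_mul_sqrt _ _ _

variable [DecidableEq J]

/-- The outcome weights of a rank-one measurement, given by the rows of an isometry `v`, sum to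
the trace. -/
theorem sum_dotProduct_mulVec_eq_trace {v : Matrix X J ℂ} (hv : v.conjTranspose * v = 1)
    (A : Matrix J J ℂ) : ∑ x, star (v x) ⬝ᵥ A.mulVec (v x) = A.trace := by
  have h : ∀ a b, ∑ x, star (v x a) * v x b = (1 : Matrix J J ℂ) a b := by
    intro a b
    rw [← hv]
    rfl
  simp only [dotProduct, Matrix.mulVec, Finset.mul_sum, Pi.star_apply]
  rw [Finset.sum_comm, Matrix.trace]
  refine Finset.sum_congr rfl fun a _ => ?_
  rw [Finset.sum_comm]
  calc ∑ b, ∑ x, star (v x a) * (A a b * v x b)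
      = ∑ b, A a b * (1 : Matrix J J ℂ) a b := by
        refine Finset.sum_congr rfl fun b _ => ?_
        rw [← h, Finset.mul_sum]
        exact Finset.sum_congr rfl fun x _ => by ring
    _ = A.diag a := by simp [Matrix.one_apply]

theorem sum_qform_eq_re_trace {v : Matrix X J ℂ} (hv : v.conjTranspose * v = 1)
    (A : Matrix J J ℂ) : ∑ x, qform A (v x) = A.trace.re := by
  rw [← sum_dotProduct_mulVec_eq_trace hv, Complex.re_sum]
  rfl

/-- The overlap `tr √ρ√σ` is at most the Bhattacharyya coefficient of the outcome distributions
of a rank-one measurement. -/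
theorem re_trace_msqrt_mul_msqrt_le {v : Matrix X J ℂ} (hv : v.conjTranspose * v = 1)
    {ρ σ : Matrix J J ℂ} (hρ : ρ.PosSemidef) (hσ : σ.PosSemidef) :
    ((msqrt ρ * msqrt σ).trace).re ≤ ∑ x, √(qform ρ (v x)) * √(qform σ (v x)) := by
  rw [← sum_dotProduct_mulVec_eq_trace hv, Complex.re_sum]
  refine Finset.sum_le_sum fun x _ => ?_
  have h := re_dotProduct_mulVec_mul_le (isHermitian_fcal Real.sqrt ρ)
    (isHermitian_fcal Real.sqrt σ) (v x)
  change _ ≤ √(qform (msqrt ρ * msqrt ρ) _) * √(qform (msqrt σ * msqrt σ) _) at h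
  rwa [msqrt_mul_msqrt hρ, msqrt_mul_msqrt hσ] at h

end Measurement

section TensorProduct

variable {κ : Type*} [Fintype κ]

/-- Tensor product of a family of rectangular matrices. -/
def tensor {α β : κ → Type*} (K : ∀ c, Matrix (α c) (β c) ℂ) : Matrix (∀ c, α c) (∀ c, β c) ℂ :=
  fun x y => ∏ c, K c (x c) (y c)

theorem tensor_conjTranspose {α β : κ → Type*} (K : ∀ c, Matrix (α c) (β c) ℂ) :
    (tensor K).conjTranspose = tensor fun c => (K c).conjTranspose := by
  ext x y
  simp [tensor, Matrix.conjTranspose_apply, star_prod]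

theorem tensor_one {α : κ → Type*} [∀ c, DecidableEq (α c)] :
    tensor (fun c => (1 : Matrix (α c) (α c) ℂ)) = 1 := by
  ext x y
  rw [tensor, Matrix.one_apply]
  split_ifs with h
  · subst h
    exact Finset.prod_eq_one fun c _ => Matrix.one_apply_eq _
  · obtain ⟨c, hc⟩ := Function.ne_iff.1 h
    exact Finset.prod_eq_zero (Finset.mem_univ c) (Matrix.one_apply_ne hc)

variable [DecidableEq κ]

theorem sum_prod_pi {β : κ → Type*} [∀ c, Fintype (β c)] (f : ∀ c, β c → ℂ) :
    ∑ y : ∀ c, β c, ∏ c, f c (y c) = ∏ c, ∑ b, f c b := by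
  rw [Finset.prod_univ_sum, Fintype.piFinset_univ]

theorem tensor_mul_tensor {α β γ : κ → Type*} [∀ c, Fintype (β c)]
    (K : ∀ c, Matrix (α c) (β c) ℂ) (L : ∀ c, Matrix (β c) (γ c) ℂ) :
    tensor K * tensor L = tensor fun c => K c * L c := by
  ext x y
  simp only [tensor, Matrix.mul_apply, ← Finset.prod_mul_distrib]
  exact sum_prod_pi fun c b => K c (x c) b * L c b (y c)

theorem trace_tensor {α : κ → Type*} [∀ c, Fintype (α c)] (A : ∀ c, Matrix (α c) (α c) ℂ) :
    (tensor A).trace = ∏ c, (A c).trace :=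
  sum_prod_pi fun c a => A c a a

theorem PosSemidef.exists_eq_conjTranspose_mul_self {J : Type*} [Fintype J] {A : Matrix J J ℂ}
    (hA : A.PosSemidef) : ∃ B : Matrix J J ℂ, A = B.conjTranspose * B := by
  classical
  exact ⟨msqrt A, by rw [(show (msqrt A).IsHermitian from isHermitian_fcal _ _).eq,
    msqrt_mul_msqrt hA]⟩

theorem posSemidef_tensor {α : κ → Type*} [∀ c, Fintype (α c)] {A : ∀ c, Matrix (α c) (α c) ℂ}
    (hA : ∀ c, (A c).PosSemidef) : (tensor A).PosSemidef := by
  choose B hB using fun c => PosSemidef.exists_eq_conjTranspose_mul_self (hA c)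
  rw [show A = fun c => (B c).conjTranspose * B c from funext hB, ← tensor_mul_tensor,
    ← tensor_conjTranspose]
  exact Matrix.posSemidef_conjTranspose_mul_self _

end TensorProduct

section Tomography

/-- A rank-one measurement, given by the rows of a matrix, whose outcome probabilities determine
the measured operator. -/
structure IsInfoComplete {X J : Type*} [Fintype X] [DecidableEq J] (v : Matrix X J ℂ) : Prop where
  conjTranspose_mul_self : v.conjTranspose * v = 1
  exists_dual : ∃ c : J → J → X → ℂ, ∀ a b y z,
    ∑ x, c a b x * (star (v x y) * v x z) = if y = a ∧ z = b then 1 else 0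

theorem IsInfoComplete.eq_of_qform_eq {X J : Type*} [Fintype X] [Fintype J] [DecidableEq J]
    {v : Matrix X J ℂ} (hv : IsInfoComplete v) {ρ σ : Matrix J J ℂ} (hρ : ρ.PosSemidef)
    (hσ : σ.PosSemidef) (h : ∀ x, qform ρ (v x) = qform σ (v x)) : ρ = σ := by
  obtain ⟨c, hc⟩ := hv.exists_dual
  have key : ∀ (A : Matrix J J ℂ) a b,
      A a b = ∑ x, c a b x * (star (v x) ⬝ᵥ A.mulVec (v x)) := by
    intro A a b
    simp only [dotProduct, Matrix.mulVec, Finset.mul_sum, Pi.star_apply]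
    rw [Finset.sum_comm]
    have : ∀ y z, ∑ x, c a b x * (star (v x y) * (A y z * v x z)) =
        A y z * if y = a ∧ z = b then 1 else 0 := by
      intro y z
      rw [← hc, Finset.mul_sum]
      exact Finset.sum_congr rfl fun x _ => by ring
    simp_rw [Finset.sum_comm (s := Finset.univ (α := X)), this]
    simp [ite_and]
  ext a b
  rw [key ρ, key σ]
  simp only [dotProduct_mulVec_eq_qform hρ, dotProduct_mulVec_eq_qform hσ, h]

theorem isInfoComplete_tensor {κ : Type*} [Fintype κ] [DecidableEq κ] {X J : κ → Type*}
    [∀ c, Fintype (X c)] [∀ c, DecidableEq (J c)]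
    {v : ∀ c, Matrix (X c) (J c) ℂ} (hv : ∀ c, IsInfoComplete (v c)) :
    IsInfoComplete (tensor v) := by
  refine ⟨?_, ?_⟩
  · rw [tensor_conjTranspose, tensor_mul_tensor,
      funext fun c => (hv c).conjTranspose_mul_self, tensor_one]
  · choose c hc using fun i => (hv i).exists_dual
    refine ⟨fun a b x => ∏ i, c i (a i) (b i) (x i), fun a b y z => ?_⟩
    simp only [tensor, star_prod, ← Finset.prod_mul_distrib]
    rw [sum_prod_pi fun i x => c i (a i) (b i) x * (star (v i x (y i)) * v i x (z i))]
    simp only [hc]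
    rw [Finset.prod_ite_zero]
    simp [forall_and, funext_iff]

theorem exists_isInfoComplete (J : Type*) [Fintype J] [DecidableEq J] [Nonempty J] :
    ∃ v : Matrix (J × J × Fin 4) J ℂ, IsInfoComplete v := by
  let r : ℝ := √(8 * Fintype.card J)
  have hr : ((r : ℂ))⁻¹ * (r : ℂ)⁻¹ = (8 * Fintype.card J : ℂ)⁻¹ := by
    rw [← mul_inv, ← Complex.ofReal_mul, Real.mul_self_sqrt (by positivity)]
    push_cast
    rfl
  have hcard : (Fintype.card J : ℂ) ≠ 0 := Nat.cast_ne_zero.2 Fintype.card_ne_zero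
  have hI2 : Complex.I ^ 2 = -1 := Complex.I_sq
  have hI3 : Complex.I ^ 3 = -Complex.I := Complex.I_pow_three
  have hmul : ∀ a b y z : J, ∀ s : Fin 4,
      (starRingEnd ℂ) ((r : ℂ)⁻¹ * ((if y = a then 1 else 0) +
        Complex.I ^ (s : ℕ) * if y = b then 1 else 0)) *
      ((r : ℂ)⁻¹ * ((if z = a then 1 else 0) + Complex.I ^ (s : ℕ) * if z = b then 1 else 0)) =
      (8 * Fintype.card J : ℂ)⁻¹ *
      (((if y = a then 1 else 0) + (-Complex.I) ^ (s : ℕ) * if y = b then 1 else 0) *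
      ((if z = a then 1 else 0) + Complex.I ^ (s : ℕ) * if z = b then 1 else 0)) := by
    intro a b y z s
    rw [← hr]
    simp only [map_mul, map_add, map_inv₀, Complex.conj_ofReal, map_pow, Complex.conj_I,
      apply_ite (starRingEnd ℂ), map_one, map_zero]
    ring
  refine ⟨Matrix.of fun x y => (r : ℂ)⁻¹ * ((if y = x.1 then 1 else 0) +
    Complex.I ^ (x.2.2 : ℕ) * if y = x.2.1 then 1 else 0), ?_, ?_⟩
  · ext y z
    simp only [Matrix.mul_apply, Matrix.conjTranspose_apply, Matrix.of_apply,
      RCLike.star_def, hmul,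
      Fintype.sum_prod_type, ← Finset.mul_sum]
    have hs : ∀ a b : J, ∑ s : Fin 4,
        (((if y = a then 1 else 0) + (-Complex.I) ^ (s : ℕ) * if y = b then 1 else 0) *
        ((if z = a then 1 else 0) + Complex.I ^ (s : ℕ) * if z = b then 1 else 0)) =
        4 * ((if y = a then 1 else 0) * (if z = a then 1 else 0)) +
        4 * ((if y = b then 1 else 0) * (if z = b then 1 else 0)) := by
      intro a b
      simp only [Fin.sum_univ_four, Fin.val_zero, Fin.val_one, Fin.val_two,
        show ((3 : Fin 4) : ℕ) = 3 from rfl, neg_pow Complex.I 3, neg_pow Complex.I 2, hI2, hI3]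
      linear_combination (-2 * (if y = b then 1 else 0) * (if z = b then 1 else 0)) * hI2
    simp only [hs]
    by_cases hyz : y = z
    · subst hyz
      simp [Finset.sum_add_distrib]
      field_simp
      norm_num
    · simp [Finset.sum_add_distrib, hyz]
  · refine ⟨fun a b x => if x.1 = a ∧ x.2.1 = b then
      2 * Fintype.card J * (-Complex.I) ^ (x.2.2 : ℕ) else 0, fun a b y z => ?_⟩
    have hs : ∑ s : Fin 4, 2 * (Fintype.card J : ℂ) * (-Complex.I) ^ (s : ℕ) *
        ((8 * Fintype.card J : ℂ)⁻¹ *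
        (((if y = a then 1 else 0) + (-Complex.I) ^ (s : ℕ) * if y = b then 1 else 0) *
        ((if z = a then 1 else 0) + Complex.I ^ (s : ℕ) * if z = b then 1 else 0))) =
        (if y = a then 1 else 0) * (if z = b then 1 else 0) := by
      field_simp
      simp only [Fin.sum_univ_four, Fin.val_zero, Fin.val_one, Fin.val_two,
        show ((3 : Fin 4) : ℕ) = 3 from rfl, neg_pow Complex.I 3, neg_pow Complex.I 2, hI2, hI3]
      linear_combination (-(1 / 2) * (if y = a then 1 else 0) * (if z = b then 1 else 0) +
        1 / 2 * (if y = b then 1 else 0) * (if z = a then 1 else 0)) * hI2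
    simp only [Matrix.of_apply, RCLike.star_def, hmul, Fintype.sum_prod_type]
    rw [Finset.sum_eq_single a (by intro a' _ h; simp [h]) (by simp),
      Finset.sum_eq_single b (by intro b' _ h; simp [h]) (by simp)]
    simp only [and_self, if_true, hs]
    by_cases hy : y = a <;> by_cases hz : z = b <;> simp [hy, hz]

end Tomography

section Separable

theorem isCompact_convexHull_of_finiteDimensional {E : Type*} [AddCommGroup E] [Module ℝ E]
    [TopologicalSpace E] [ContinuousAdd E] [ContinuousSMul ℝ E] [FiniteDimensional ℝ E]
    {s : Set E} (hs : IsCompact s) : IsCompact (convexHull ℝ s) := by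
  rcases s.eq_empty_or_nonempty with rfl | ⟨x₀, hx₀⟩
  · simp
  let N := Module.finrank ℝ E + 1
  have himage : convexHull ℝ s = (fun q : (Fin N → ℝ) × (Fin N → E) => ∑ i, q.1 i • q.2 i) ''
      (stdSimplex ℝ (Fin N) ×ˢ Set.univ.pi fun _ => s) := by
    apply Set.Subset.antisymm
    · intro x hx
      obtain ⟨ι, _, z, w, hz, haff, hw0, hw1, rfl⟩ := eq_pos_convex_span_of_mem_convexHull hx
      obtain ⟨e⟩ : Nonempty (ι ↪ Fin N) := Function.Embedding.nonempty_of_card_le (by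
        rw [Fintype.card_fin]
        exact haff.card_le_finrank_succ.trans
          (Nat.add_le_add_right (Submodule.finrank_le _) 1))
      have hext : ∀ j ∉ Set.range e, Function.extend e w 0 j = 0 := fun j hj =>
        Function.extend_apply' _ _ _ hj
      refine ⟨(Function.extend e w 0, Function.extend e z fun _ => x₀), ⟨⟨fun j => ?_, ?_⟩, ?_⟩, ?_⟩
      · by_cases hj : j ∈ Set.range e
        · obtain ⟨i, rfl⟩ := hj
          simpa [e.injective.extend_apply] using (hw0 i).le
        · exact (hext j hj).ge
      · rw [← hw1]
        exact (Fintype.sum_of_injective e e.injective _ _ hext fun i =>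
          (e.injective.extend_apply _ _ _).symm).symm
      · intro j _
        by_cases hj : j ∈ Set.range e
        · obtain ⟨i, rfl⟩ := hj
          simpa [e.injective.extend_apply] using hz ⟨i, rfl⟩
        · simpa [Function.extend_apply' _ _ _ hj] using hx₀
      · refine (Fintype.sum_of_injective e e.injective _ _ (fun j hj => ?_) fun i => ?_).symm
        · simp [hext j hj]
        · simp [e.injective.extend_apply]
    · rintro _ ⟨⟨w, z⟩, ⟨⟨hw0, hw1⟩, hz⟩, rfl⟩
      exact mem_convexHull_of_exists_fintype w z hw0 hw1 (fun i => hz i (Set.mem_univ i)) rfl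
  rw [himage]
  refine ((isCompact_stdSimplex ℝ (Fin N)).prod (isCompact_univ_pi fun _ => hs)).image ?_
  fun_prop

theorem isCompact_setOf_isState (J : Type*) [Fintype J] :
    IsCompact {A : Matrix J J ℂ | IsState A} := by
  have himage : {A : Matrix J J ℂ | IsState A} =
      (fun B : Matrix J J ℂ => B.conjTranspose * B) ''
        {B : Matrix J J ℂ | (B.conjTranspose * B).trace = 1} := by
    ext A
    constructor
    · rintro ⟨hA, htr⟩
      obtain ⟨B, rfl⟩ := PosSemidef.exists_eq_conjTranspose_mul_self hA
      exact ⟨B, htr, rfl⟩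
    · rintro ⟨B, hB, rfl⟩
      exact ⟨Matrix.posSemidef_conjTranspose_mul_self B, hB⟩
  have hcont : Continuous fun B : Matrix J J ℂ => B.conjTranspose * B := by fun_prop
  rw [himage]
  refine IsCompact.image ?_ hcont
  have hball : IsCompact (Set.univ.pi fun _ : J => Set.univ.pi fun _ : J =>
      Metric.closedBall (0 : ℂ) 1) :=
    isCompact_univ_pi fun _ => isCompact_univ_pi fun _ => isCompact_closedBall _ _
  refine hball.of_isClosed_subset (isClosed_eq hcont.matrix_trace continuous_const) ?_
  intro (B : Matrix J J ℂ) hB a _ b _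
  have htr : ∑ c, ∑ e, ‖B e c‖ ^ 2 = 1 := by
    have h := congrArg Complex.re (show (B.conjTranspose * B).trace = 1 from hB)
    simp only [Matrix.trace, Matrix.diag, Matrix.mul_apply, Complex.re_sum,
      Matrix.conjTranspose_apply, Complex.one_re] at h
    rw [← h]
    refine Finset.sum_congr rfl fun c _ => Finset.sum_congr rfl fun e _ => ?_
    rw [RCLike.star_def, mul_comm, Complex.mul_conj, Complex.ofReal_re, Complex.normSq_eq_norm_sq]
  have h1 : ‖B a b‖ ^ 2 ≤ 1 := by
    rw [← htr]
    refine (Finset.single_le_sum (f := fun e => ‖B e b‖ ^ 2) (fun _ _ => by positivity)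
      (Finset.mem_univ a)).trans ?_
    exact Finset.single_le_sum (f := fun c => ∑ e, ‖B e c‖ ^ 2)
      (fun _ _ => Finset.sum_nonneg fun _ _ => by positivity) (Finset.mem_univ b)
  rw [mem_closedBall_zero_iff]
  exact (sq_le_one_iff₀ (norm_nonneg _)).1 h1

variable {k : ℕ} {ι : Fin k → Type*} [∀ i, Fintype (ι i)]

theorem posSemidef_prodOp {A : ∀ i, Matrix (ι i) (ι i) ℂ} (hA : ∀ i, (A i).PosSemidef) :
    (prodOp A).PosSemidef :=
  posSemidef_tensor hA

theorem setOf_isSeparable_eq_convexHull :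
    {σ : Matrix (∀ i, ι i) (∀ i, ι i) ℂ | IsSeparable σ} =
      convexHull ℝ (prodOp '' {A : ∀ i, Matrix (ι i) (ι i) ℂ | ∀ i, IsState (A i)}) := by
  apply Set.Subset.antisymm
  · rintro _ ⟨m, p, A, hp0, hp1, hA, rfl⟩
    exact mem_convexHull_of_exists_fintype p (fun j => prodOp (A j)) hp0 hp1
      (fun j => ⟨A j, hA j, rfl⟩) rfl
  · intro σ hσ
    obtain ⟨J, _, p, z, hp0, hp1, hz, rfl⟩ := mem_convexHull_iff_exists_fintype.1 hσ
    choose A hA hAz using hz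
    let e := (Fintype.equivFin J).symm
    refine ⟨Fintype.card J, p ∘ e, A ∘ e, fun j => hp0 _, ?_, fun j => hA _, ?_⟩
    · rw [← hp1]
      exact e.sum_comp p
    · simp only [Function.comp_apply, hAz]
      exact (e.sum_comp fun j => p j • z j).symm

theorem isCompact_setOf_isSeparable :
    IsCompact {σ : Matrix (∀ i, ι i) (∀ i, ι i) ℂ | IsSeparable σ} := by
  rw [setOf_isSeparable_eq_convexHull]
  refine isCompact_convexHull_of_finiteDimensional (IsCompact.image ?_ ?_)
  · have h : {A : ∀ i, Matrix (ι i) (ι i) ℂ | ∀ i, IsState (A i)} =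
        Set.univ.pi fun i => {A : Matrix (ι i) (ι i) ℂ | IsState A} := by
      ext A
      simp
    rw [h]
    exact isCompact_univ_pi fun i => isCompact_setOf_isState (ι i)
  · refine continuous_matrix fun x y => ?_
    unfold prodOp
    fun_prop

theorem IsSeparable.isState {σ : Matrix (∀ i, ι i) (∀ i, ι i) ℂ} (hσ : IsSeparable σ) :
    IsState σ := by
  obtain ⟨m, p, A, hp0, hp1, hA, rfl⟩ := hσ
  refine ⟨Matrix.posSemidef_sum _ fun j _ =>
    (posSemidef_prodOp fun i => (hA j i).1).smul (hp0 j), ?_⟩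
  have htr : ∀ j, (prodOp (A j)).trace = 1 := fun j => by
    rw [show prodOp (A j) = tensor (A j) from rfl, trace_tensor]
    exact Finset.prod_eq_one fun i _ => (hA j i).2
  simp only [Matrix.trace_sum, Matrix.trace_smul, htr]
  rw [← Finset.sum_smul, hp1, one_smul]

/-- The cone of unnormalized separable states. -/
def InSepCone (σ : Matrix (∀ i, ι i) (∀ i, ι i) ℂ) : Prop :=
  ∃ s : ℝ, 0 ≤ s ∧ ∃ τ, IsSeparable τ ∧ σ = s • τ

theorem InSepCone.smul {σ : Matrix (∀ i, ι i) (∀ i, ι i) ℂ} (hσ : InSepCone σ) {t : ℝ}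
    (ht : 0 ≤ t) : InSepCone (t • σ) := by
  obtain ⟨s, hs, τ, hτ, rfl⟩ := hσ
  exact ⟨t * s, mul_nonneg ht hs, τ, hτ, smul_smul _ _ _⟩

theorem InSepCone.add {σ σ' : Matrix (∀ i, ι i) (∀ i, ι i) ℂ} (hσ : InSepCone σ)
    (hσ' : InSepCone σ') : InSepCone (σ + σ') := by
  obtain ⟨s, hs, τ, hτ, rfl⟩ := hσ
  obtain ⟨s', hs', τ', hτ', rfl⟩ := hσ'
  rcases (add_nonneg hs hs').eq_or_lt with h | h
  · refine ⟨0, le_rfl, τ, hτ, ?_⟩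
    rw [show s = 0 by linarith, show s' = 0 by linarith]
    simp
  · refine ⟨s + s', h.le, (s / (s + s')) • τ + (s' / (s + s')) • τ', ?_, ?_⟩
    · have hconv : Convex ℝ {σ : Matrix (∀ i, ι i) (∀ i, ι i) ℂ | IsSeparable σ} := by
        rw [setOf_isSeparable_eq_convexHull]
        exact convex_convexHull ℝ _
      exact hconv hτ hτ' (by positivity) (by positivity) (by field_simp)
    · rw [smul_add, smul_smul, smul_smul, mul_div_cancel₀ _ h.ne', mul_div_cancel₀ _ h.ne']

theorem InSepCone.trace_smul {σ : Matrix (∀ i, ι i) (∀ i, ι i) ℂ} (hσ : InSepCone σ) :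
    ∃ τ, IsSeparable τ ∧ 0 ≤ σ.trace.re ∧ σ = σ.trace.re • τ := by
  obtain ⟨s, hs, τ, hτ, rfl⟩ := hσ
  have htr : (s • τ).trace.re = s := by simp [Matrix.trace_smul, hτ.isState.2]
  exact ⟨τ, hτ, by rwa [htr], by rw [htr]⟩

variable [∀ i, Nonempty (ι i)]

theorem exists_isState (J : Type*) [Fintype J] [Nonempty J] : ∃ A : Matrix J J ℂ, IsState A := by
  classical
  refine ⟨(Fintype.card J : ℝ)⁻¹ • 1, Matrix.PosSemidef.one.smul (by positivity), ?_⟩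
  have : (Fintype.card J : ℂ) ≠ 0 := Nat.cast_ne_zero.2 Fintype.card_ne_zero
  simp [Matrix.trace_smul, this]

theorem exists_separable : ∃ σ : Matrix (∀ i, ι i) (∀ i, ι i) ℂ, IsSeparable σ := by
  choose A hA using fun i => exists_isState (ι i)
  exact ⟨prodOp A, 1, fun _ => 1, fun _ => A, by simp, by simp, fun _ => hA, by simp⟩

theorem PosSemidef.exists_eq_trace_smul_isState {J : Type*} [Fintype J] [Nonempty J]
    {A : Matrix J J ℂ} (hA : A.PosSemidef) :
    ∃ (s : ℝ) (B : Matrix J J ℂ), 0 ≤ s ∧ IsState B ∧ A = s • B := by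
  have h0 := Complex.nonneg_iff.1 hA.trace_nonneg
  have htr : A.trace = (A.trace.re : ℂ) := Complex.ext rfl h0.2.symm
  rcases h0.1.eq_or_lt with h | h
  · obtain ⟨B, hB⟩ := exists_isState J
    refine ⟨0, B, le_rfl, hB, ?_⟩
    rw [zero_smul, ← hA.trace_eq_zero_iff, htr, ← h, Complex.ofReal_zero]
  · refine ⟨A.trace.re, A.trace.re⁻¹ • A, h.le, ⟨hA.smul (inv_nonneg.2 h.le), ?_⟩, ?_⟩
    · rw [Matrix.trace_smul, htr, Complex.ofReal_re, Complex.real_smul, ← Complex.ofReal_mul,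
        inv_mul_cancel₀ h.ne', Complex.ofReal_one]
    · rw [smul_smul, mul_inv_cancel₀ h.ne', one_smul]

theorem inSepCone_prodOp {A : ∀ i, Matrix (ι i) (ι i) ℂ} (hA : ∀ i, (A i).PosSemidef) :
    InSepCone (prodOp A) := by
  choose s B hs hB hAB using fun i => PosSemidef.exists_eq_trace_smul_isState (hA i)
  refine ⟨∏ i, s i, Finset.prod_nonneg fun i _ => hs i, prodOp B,
    ⟨1, fun _ => 1, fun _ => B, by simp, by simp, fun _ => hB, by simp⟩, ?_⟩
  ext x y
  simp only [prodOp, hAB, Matrix.smul_apply, Complex.real_smul, Finset.prod_mul_distrib,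
    Complex.ofReal_prod]

theorem inSepCone_sum {J : Type*} (t : Finset J) {σ : J → Matrix (∀ i, ι i) (∀ i, ι i) ℂ}
    (hσ : ∀ j ∈ t, InSepCone (σ j)) : InSepCone (∑ j ∈ t, σ j) := by
  refine Finset.sum_induction σ InSepCone (fun _ _ => InSepCone.add) ?_ hσ
  obtain ⟨τ, hτ⟩ := exists_separable (ι := ι)
  exact ⟨0, le_rfl, τ, hτ, (zero_smul _ _).symm⟩

/-- Local Kraus operators map separable states into the separable cone. -/
theorem IsSeparable.inSepCone_conjTranspose_mul_mul {κ : Fin k → Type*} [∀ i, Fintype (κ i)]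
    {σ : Matrix (∀ i, κ i) (∀ i, κ i) ℂ} (hσ : IsSeparable σ) (K : ∀ i, Matrix (κ i) (ι i) ℂ) :
    InSepCone ((tensor K).conjTranspose * σ * tensor K) := by
  obtain ⟨m, p, A, hp0, hp1, hA, rfl⟩ := hσ
  rw [Matrix.mul_sum, Matrix.sum_mul]
  refine inSepCone_sum _ fun j _ => ?_
  rw [Matrix.mul_smul, Matrix.smul_mul]
  refine InSepCone.smul ?_ (hp0 j)
  rw [show prodOp (A j) = tensor (A j) from rfl, tensor_conjTranspose, tensor_mul_tensor,
    tensor_mul_tensor]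
  exact inSepCone_prodOp fun i => (hA j i).1.conjTranspose_mul_mul_same (K i)

end Separable

section Copies

variable {k : ℕ} {ι : Fin k → Type*}

/-- Tensor power of a measurement of a `k`-partite system; the `i`-th party holds all the copies
of its own system. -/
def measPow {X : Type*} (F : Matrix X (∀ i, ι i) ℂ) (n : ℕ) :
    Matrix (Fin n → X) (∀ i, Fin n → ι i) ℂ :=
  (tensor fun _ : Fin n => F).submatrix id (fun y t i => y i t)

theorem measPow_apply {X : Type*} (F : Matrix X (∀ i, ι i) ℂ) (n : ℕ) (x : Fin n → X)
    (y : ∀ i, Fin n → ι i) : measPow F n x y = ∏ t, F (x t) fun i => y i t := rfl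

theorem measPow_conjTranspose_mul_self {X : Type*} [Fintype X] [∀ i, DecidableEq (ι i)]
    {F : Matrix X (∀ i, ι i) ℂ} (hF : F.conjTranspose * F = 1) (n : ℕ) :
    (measPow F n).conjTranspose * measPow F n = 1 := by
  rw [measPow, Matrix.conjTranspose_submatrix,
    ← Matrix.submatrix_mul _ _ _ id _ Function.bijective_id,
    tensor_conjTranspose, tensor_mul_tensor, hF, tensor_one]
  exact Matrix.submatrix_one_equiv (Equiv.piComm fun _ : Fin k => fun _ : Fin n => _)

/-- Contraction of the first copy of one party's system with a vector. -/
def fixHead {J : Type*} [DecidableEq J] {n : ℕ} (v : J → ℂ) :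
    Matrix (Fin (n + 1) → J) (Fin n → J) ℂ :=
  Matrix.of fun z y => if Fin.tail z = y then v (z 0) else 0

/-- Contraction of all but the first copy of one party's system with a basis vector. -/
def fixTail {J : Type*} [DecidableEq J] {n : ℕ} (w : Fin n → J) :
    Matrix (Fin (n + 1) → J) J ℂ :=
  Matrix.of fun z a => if z 0 = a then (if Fin.tail z = w then 1 else 0) else 0

variable [∀ i, Fintype (ι i)] [∀ i, DecidableEq (ι i)]

theorem tensor_fixHead_mulVec {n : ℕ} (v : ∀ i, ι i → ℂ) (g : (∀ i, Fin n → ι i) → ℂ)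
    (z : ∀ i, Fin (n + 1) → ι i) :
    (tensor fun i => fixHead (n := n) (v i)).mulVec g z =
      (∏ i, v i (z i 0)) * g fun i => Fin.tail (z i) := by
  rw [Matrix.mulVec, dotProduct, Finset.sum_eq_single fun i => Fin.tail (z i)]
  · simp [tensor, fixHead]
  · intro y _ hy
    obtain ⟨i, hi⟩ := Function.ne_iff.1 hy
    rw [tensor, Finset.prod_eq_zero (Finset.mem_univ i), zero_mul]
    simp [fixHead, hi.symm]
  · simp

theorem tensor_fixTail_mulVec {n : ℕ} (w : ∀ i, Fin n → ι i) (g : (∀ i, ι i) → ℂ)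
    (z : ∀ i, Fin (n + 1) → ι i) :
    (tensor fun i => fixTail (w i)).mulVec g z =
      (if (fun i => Fin.tail (z i)) = w then 1 else 0) * g fun i => z i 0 := by
  rw [Matrix.mulVec, dotProduct, Finset.sum_eq_single fun i => z i 0]
  · simp only [tensor, fixTail, Matrix.of_apply, if_true]
    rw [Finset.prod_ite_zero]
    simp [funext_iff]
  · intro y _ hy
    obtain ⟨i, hi⟩ := Function.ne_iff.1 hy
    rw [tensor, Finset.prod_eq_zero (Finset.mem_univ i), zero_mul]
    simp [fixTail, hi.symm]
  · simp

variable {X : Fin k → Type*} (v : ∀ i, Matrix (X i) (ι i) ℂ)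

theorem tensor_fixHead_mulVec_measPow {n : ℕ} (x₀ : ∀ i, X i) (x : Fin n → ∀ i, X i) :
    (tensor fun i => fixHead (n := n) (v i (x₀ i))).mulVec (measPow (tensor v) n x) =
      measPow (tensor v) (n + 1) (Fin.cons x₀ x : Fin (n + 1) → ∀ i, X i) := by
  ext z
  rw [tensor_fixHead_mulVec, measPow_apply, measPow_apply, Fin.prod_univ_succ]
  rfl

/-- The state of the remaining copies after outcome `x₀` on the first copy (unnormalized). -/
def condState {n : ℕ} (σ : Matrix (∀ i, Fin (n + 1) → ι i) (∀ i, Fin (n + 1) → ι i) ℂ)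
    (x₀ : ∀ i, X i) : Matrix (∀ i, Fin n → ι i) (∀ i, Fin n → ι i) ℂ :=
  (tensor fun i => fixHead (n := n) (v i (x₀ i))).conjTranspose * σ *
    tensor fun i => fixHead (n := n) (v i (x₀ i))

/-- The reduced state of the first copy. -/
def headState {n : ℕ} (σ : Matrix (∀ i, Fin (n + 1) → ι i) (∀ i, Fin (n + 1) → ι i) ℂ) :
    Matrix (∀ i, ι i) (∀ i, ι i) ℂ :=
  ∑ w : ∀ i, Fin n → ι i, (tensor fun i => fixTail (w i)).conjTranspose * σ *
    tensor fun i => fixTail (w i)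

theorem qform_condState {n : ℕ}
    (σ : Matrix (∀ i, Fin (n + 1) → ι i) (∀ i, Fin (n + 1) → ι i) ℂ)
    (x₀ : ∀ i, X i) (x : Fin n → ∀ i, X i) :
    qform (condState v σ x₀) (measPow (tensor v) n x) =
      qform σ (measPow (tensor v) (n + 1) (Fin.cons x₀ x : Fin (n + 1) → ∀ i, X i)) := by
  rw [condState, qform_conjTranspose_mul_mul, tensor_fixHead_mulVec_measPow]

theorem re_trace_condState {n : ℕ}
    (σ : Matrix (∀ i, Fin (n + 1) → ι i) (∀ i, Fin (n + 1) → ι i) ℂ) (x₀ : ∀ i, X i) :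
    (condState v σ x₀).trace.re = qform (headState σ) (tensor v x₀) := by
  have hvec : ∀ w : ∀ i, Fin n → ι i,
      (tensor fun i => fixTail (w i)).mulVec (tensor v x₀) =
        (tensor fun i => fixHead (n := n) (v i (x₀ i))).mulVec (Pi.single w 1) := by
    intro w
    ext z
    rw [tensor_fixTail_mulVec, tensor_fixHead_mulVec, Pi.single_apply, mul_comm]
    rfl
  have hsum : qform (headState σ) (tensor v x₀) = ∑ w : ∀ i, Fin n → ι i,
      qform ((tensor fun i => fixTail (w i)).conjTranspose * σ * tensor fun i => fixTail (w i))
        (tensor v x₀) := by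
    simp only [qform, headState, Matrix.sum_mulVec, dotProduct_sum, Complex.re_sum]
  rw [hsum, Matrix.trace, Complex.re_sum]
  refine Finset.sum_congr rfl fun w _ => ?_
  rw [qform_conjTranspose_mul_mul, hvec, ← qform_conjTranspose_mul_mul]
  simp [qform, condState]

variable {v} [∀ i, Fintype (X i)]

theorem re_trace_headState (hv : ∀ i, IsInfoComplete (v i)) {n : ℕ}
    (σ : Matrix (∀ i, Fin (n + 1) → ι i) (∀ i, Fin (n + 1) → ι i) ℂ) :
    (headState σ).trace.re = σ.trace.re := by
  have hF := (isInfoComplete_tensor hv).conjTranspose_mul_self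
  rw [← sum_qform_eq_re_trace hF, ← sum_qform_eq_re_trace (measPow_conjTranspose_mul_self hF _),
    ← (Fin.consEquiv fun _ : Fin (n + 1) => ∀ i, X i).sum_comp, Fintype.sum_prod_type]
  refine Finset.sum_congr rfl fun x₀ _ => ?_
  rw [← re_trace_condState, ← sum_qform_eq_re_trace (measPow_conjTranspose_mul_self hF _)]
  exact Finset.sum_congr rfl fun x _ => qform_condState v σ x₀ x

variable [∀ i, Nonempty (ι i)]

/-- The Bhattacharyya coefficient between an i.i.d. distribution and the outcome distribution of
a product measurement on a separable state decays exponentially in the number of copies. -/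
theorem sum_sqrt_mul_sqrt_qform_measPow_le (hv : ∀ i, IsInfoComplete (v i))
    {P : (∀ i, X i) → ℝ} {b : ℝ}
    (hb : ∀ τ : Matrix (∀ i, ι i) (∀ i, ι i) ℂ, IsSeparable τ →
      ∑ x, √(P x) * √(qform τ (tensor v x)) ≤ b) (n : ℕ)
    {σ : Matrix (∀ i, Fin n → ι i) (∀ i, Fin n → ι i) ℂ} (hσ : IsSeparable σ) :
    ∑ x : Fin n → ∀ i, X i, (∏ t, √(P (x t))) * √(qform σ (measPow (tensor v) n x)) ≤ b ^ n := by
  have hF := (isInfoComplete_tensor hv).conjTranspose_mul_self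
  have hb0 : 0 ≤ b := by
    obtain ⟨τ, hτ⟩ := exists_separable (ι := ι)
    exact (Finset.sum_nonneg fun x _ => by positivity).trans (hb τ hτ)
  induction n with
  | zero =>
    have h := sum_qform_eq_re_trace (measPow_conjTranspose_mul_self hF 0) σ
    rw [hσ.isState.2, Complex.one_re, Fintype.sum_unique] at h
    rw [Fintype.sum_unique, h]
    simp
  | succ n ih =>
    rw [← (Fin.consEquiv fun _ : Fin (n + 1) => ∀ i, X i).sum_comp, Fintype.sum_prod_type]
    have hcond : ∀ x₀ : ∀ i, X i, ∑ x : Fin n → ∀ i, X i,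
        (∏ t, √(P (x t))) * √(qform (condState v σ x₀) (measPow (tensor v) n x)) ≤
        √(qform (headState σ) (tensor v x₀)) * b ^ n := by
      intro x₀
      obtain ⟨τ, hτ, h0, hτeq⟩ := (hσ.inSepCone_conjTranspose_mul_mul
        fun i => fixHead (n := n) (v i (x₀ i))).trace_smul
      change 0 ≤ (condState v σ x₀).trace.re at h0
      change condState v σ x₀ = (condState v σ x₀).trace.re • τ at hτeq
      have hsqrt : ∀ w, √(qform (condState v σ x₀) w) =
          √(condState v σ x₀).trace.re * √(qform τ w) := fun w => by
        conv_lhs => rw [hτeq]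
        rw [qform_smul, Real.sqrt_mul h0]
      rw [← re_trace_condState]
      calc _ = √(condState v σ x₀).trace.re * ∑ x : Fin n → ∀ i, X i,
            (∏ t, √(P (x t))) * √(qform τ (measPow (tensor v) n x)) := by
            rw [Finset.mul_sum]
            exact Finset.sum_congr rfl fun x _ => by
              rw [hsqrt]
              ring
        _ ≤ _ := mul_le_mul_of_nonneg_left (ih hτ) (Real.sqrt_nonneg _)
    have hhead : IsSeparable (headState σ) := by
      have hcone : InSepCone (headState σ) :=
        inSepCone_sum _ fun w _ => hσ.inSepCone_conjTranspose_mul_mul fun i => fixTail (w i)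
      obtain ⟨τ, hτ, -, hτeq⟩ := hcone.trace_smul
      rw [re_trace_headState hv, hσ.isState.2, Complex.one_re, one_smul] at hτeq
      rwa [hτeq]
    calc _ = ∑ x₀, √(P x₀) * ∑ x : Fin n → ∀ i, X i, (∏ t, √(P (x t))) *
          √(qform (condState v σ x₀) (measPow (tensor v) n x)) := by
          refine Finset.sum_congr rfl fun x₀ _ => ?_
          rw [Finset.mul_sum]
          refine Finset.sum_congr rfl fun x _ => ?_
          rw [qform_condState, ← mul_assoc, Fin.prod_univ_succ]
          rfl
      _ ≤ ∑ x₀, √(P x₀) * (√(qform (headState σ) (tensor v x₀)) * b ^ n) :=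
          Finset.sum_le_sum fun x₀ _ => mul_le_mul_of_nonneg_left (hcond x₀) (Real.sqrt_nonneg _)
      _ = (∑ x₀, √(P x₀) * √(qform (headState σ) (tensor v x₀))) * b ^ n := by
          rw [Finset.sum_mul]
          exact Finset.sum_congr rfl fun x₀ _ => by ring
      _ ≤ b ^ (n + 1) := by
          rw [pow_succ']
          exact mul_le_mul_of_nonneg_right (hb _ hhead) (by positivity)

/-- A separable state cannot have the outcome statistics of an entangled one. -/
theorem exists_bhattacharyya_bound_lt_one (hv : ∀ i, IsInfoComplete (v i))
    {ρ : Matrix (∀ i, ι i) (∀ i, ι i) ℂ} (hρ : IsState ρ) (hent : ¬ IsSeparable ρ) :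
    ∃ b : ℝ, 0 < b ∧ b < 1 ∧ ∀ τ : Matrix (∀ i, ι i) (∀ i, ι i) ℂ, IsSeparable τ →
      ∑ x, √(qform ρ (tensor v x)) * √(qform τ (tensor v x)) ≤ b := by
  have hF := isInfoComplete_tensor hv
  have hcont : Continuous fun τ : Matrix (∀ i, ι i) (∀ i, ι i) ℂ =>
      ∑ x, √(qform ρ (tensor v x)) * √(qform τ (tensor v x)) :=
    continuous_finsetSum _ fun x _ =>
      continuous_const.mul (Real.continuous_sqrt.comp (continuous_qform _))
  obtain ⟨τ, hτ, hmax⟩ := isCompact_setOf_isSeparable.exists_isMaxOn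
    (exists_separable (ι := ι)) hcont.continuousOn
  have hτ' : IsSeparable τ := hτ
  have hlt : ∑ x, √(qform ρ (tensor v x)) * √(qform τ (tensor v x)) < 1 := by
    by_contra! hge
    have h1 := sum_qform_eq_re_trace hF.conjTranspose_mul_self ρ
    have h2 := sum_qform_eq_re_trace hF.conjTranspose_mul_self τ
    rw [hρ.2, Complex.one_re] at h1
    rw [hτ'.isState.2, Complex.one_re] at h2
    have hsq : ∑ x, (√(qform ρ (tensor v x)) - √(qform τ (tensor v x))) ^ 2 =
        2 - 2 * ∑ x, √(qform ρ (tensor v x)) * √(qform τ (tensor v x)) := by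
      simp only [sub_sq, Real.sq_sqrt (qform_nonneg hρ.1 _),
        Real.sq_sqrt (qform_nonneg hτ'.isState.1 _), Finset.sum_add_distrib,
        Finset.sum_sub_distrib, h1, h2, mul_assoc, ← Finset.mul_sum]
      ring
    have hzero := (Finset.sum_eq_zero_iff_of_nonneg fun x _ => sq_nonneg _).1
      (le_antisymm (by rw [hsq]; linarith) (Finset.sum_nonneg fun x _ => sq_nonneg
        (√(qform ρ (tensor v x)) - √(qform τ (tensor v x)))))
    refine hent ((hF.eq_of_qform_eq hρ.1 hτ'.isState.1 fun x => ?_) ▸ hτ')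
    have := sub_eq_zero.1 (pow_eq_zero_iff two_ne_zero |>.1 (hzero x (Finset.mem_univ x)))
    exact (Real.sqrt_inj (qform_nonneg hρ.1 _) (qform_nonneg hτ'.isState.1 _)).1 this
  exact ⟨max (∑ x, √(qform ρ (tensor v x)) * √(qform τ (tensor v x))) (1 / 2),
    lt_max_of_lt_right (by norm_num), max_lt hlt (by norm_num),
    fun τ' hτ' => (hmax hτ').trans (le_max_left _ _)⟩

end Copies

section Faithfulness

variable {k : ℕ} {d : Fin k → ℕ}

theorem tpowMulti_eq_submatrix (ρ : Matrix (∀ i, Fin (d i)) (∀ i, Fin (d i)) ℂ) (n : ℕ) :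
    tpowMulti ρ n = (tensor fun _ : Fin n => ρ).submatrix
      (Equiv.piComm fun (_ : Fin k) (_ : Fin n) => _)
      (Equiv.piComm fun (_ : Fin k) (_ : Fin n) => _) := rfl

theorem isState_tpowMulti {ρ : Matrix (∀ i, Fin (d i)) (∀ i, Fin (d i)) ℂ} (hρ : IsState ρ)
    (n : ℕ) : IsState (tpowMulti ρ n) := by
  rw [tpowMulti_eq_submatrix]
  refine ⟨(posSemidef_tensor fun _ => hρ.1).submatrix _, ?_⟩
  refine ((Equiv.piComm fun (i : Fin k) (_ : Fin n) => Fin (d i)).sum_comp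
    fun y => (tensor fun _ : Fin n => ρ) y y).trans ((trace_tensor _).trans ?_)
  simp [hρ.2]

theorem qform_tpowMulti_measPow {X : Type*} {ρ : Matrix (∀ i, Fin (d i)) (∀ i, Fin (d i)) ℂ}
    (hρ : ρ.PosSemidef) (F : Matrix X (∀ i, Fin (d i)) ℂ) (n : ℕ) (x : Fin n → X) :
    qform (tpowMulti ρ n) (measPow F n x) = ∏ t, qform ρ (F (x t)) := by
  have hprod : star (measPow F n x) ⬝ᵥ (tpowMulti ρ n).mulVec (measPow F n x) =
      ∏ t, star (F (x t)) ⬝ᵥ ρ.mulVec (F (x t)) := by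
    let e := Equiv.piComm fun (i : Fin k) (_ : Fin n) => Fin (d i)
    simp only [dotProduct, Matrix.mulVec, ← sum_prod_pi, Finset.prod_mul_distrib]
    rw [← e.sum_comp]
    refine Finset.sum_congr rfl fun y _ => ?_
    rw [← e.sum_comp]
    congr 1
    simp only [measPow_apply, Pi.star_apply, star_prod]
    rfl
  rw [qform, hprod]
  simp only [dotProduct_mulVec_eq_qform hρ, ← Complex.ofReal_prod, Complex.ofReal_re]

theorem exists_separable_suppLe {ι : Fin k → Type*} [∀ i, Fintype (ι i)]
    [∀ i, DecidableEq (ι i)] [∀ i, Nonempty (ι i)] (ρ : Matrix (∀ i, ι i) (∀ i, ι i) ℂ) :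
    ∃ ω, IsSeparable ω ∧ SuppLe ρ ω := by
  obtain ⟨ω, hω, -, hωeq⟩ := (inSepCone_prodOp fun i =>
    (Matrix.PosSemidef.one : (1 : Matrix (ι i) (ι i) ℂ).PosSemidef)).trace_smul
  rw [show prodOp (fun i => (1 : Matrix (ι i) (ι i) ℂ)) = 1 from tensor_one] at hωeq
  refine ⟨ω, hω, fun v hv => ?_⟩
  have h : v = 0 := by
    rw [← Matrix.one_mulVec v, hωeq, Matrix.smul_mulVec, hv, smul_zero]
  rw [h, Matrix.mulVec_zero]

end Faithfulness

/-- **Corollary (faithfulness of the regularized relative entropy of entanglement).**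
For every entangled state `ρ` on a finite-dimensional multipartite Hilbert space,
`E_R^∞(ρ) > 0`, where `E_R^∞(ρ) = lim_n (1/n) E_R(ρ^{⊗n})` with `ρ^{⊗n}` viewed as a
`k`-partite state in which the `i`-th party holds its `n` copies. -/
theorem regularized_relative_entropy_of_entanglement_faithful
    {k : ℕ} {d : Fin k → ℕ}
    (ρ : Matrix (∀ i, Fin (d i)) (∀ i, Fin (d i)) ℂ) (hρ : IsState ρ)
    (hent : ¬ IsSeparable ρ)
    (E : ℝ)
    (hE : Filter.Tendsto (fun n : ℕ => ERel (tpowMulti ρ n) / n) Filter.atTop (nhds E)) :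
    0 < E := by
  have hne : ∀ i, Nonempty (Fin (d i)) := by
    by_contra! h
    obtain ⟨i, hi⟩ := h
    have : IsEmpty (∀ i, Fin (d i)) := ⟨fun x => hi.false (x i)⟩
    simpa [Matrix.trace] using hρ.2
  choose v hv using fun i => exists_isInfoComplete (Fin (d i))
  have hF := (isInfoComplete_tensor hv).conjTranspose_mul_self
  obtain ⟨b, hb0, hb1, hb⟩ := exists_bhattacharyya_bound_lt_one hv hρ hent
  have hbound : ∀ n : ℕ, -2 * Real.logb 2 (b ^ n) ≤ ERel (tpowMulti ρ n) := by
    intro n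
    obtain ⟨ω₀, hω₀, hs₀⟩ := exists_separable_suppLe (tpowMulti ρ n)
    refine le_csInf ⟨_, ω₀, hω₀, hs₀, rfl⟩ ?_
    rintro _ ⟨ω, hω, hs, rfl⟩
    have hst := isState_tpowMulti hρ n
    refine neg_two_mul_logb_le_relEnt hst hω.isState.1 hs (pow_pos hb0 n) ?_
    refine (re_trace_msqrt_mul_msqrt_le (measPow_conjTranspose_mul_self hF n) hst.1
      hω.isState.1).trans (le_trans (le_of_eq ?_)
        (sum_sqrt_mul_sqrt_qform_measPow_le hv hb n hω))
    refine Finset.sum_congr rfl fun x _ => ?_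
    rw [qform_tpowMulti_measPow hρ.1, Real.sqrt_prod _ fun t _ => qform_nonneg hρ.1 _]
  have hpos : 0 < -2 * Real.logb 2 b := by
    have := Real.logb_neg one_lt_two hb0 hb1
    linarith
  refine hpos.trans_le (ge_of_tendsto hE ?_)
  filter_upwards [eventually_gt_atTop 0] with n hn
  rw [le_div_iff₀ (Nat.cast_pos.2 hn)]
  refine le_trans (le_of_eq ?_) (hbound n)
  rw [Real.logb_pow]
  ring
end GQSL
end
end
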